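/- Suppose ε_r⁻¹ satisfies the non-trapping assumptions (a), (b), (c). Then there exists a constant C > 0, independent of k, such that every homogeneous radiating solution H satisfies C ∫_Ω |∂H/∂x₃|² dx ≤ ∫_Ω x₃ (∂ε_r⁻¹/∂x₃) |curl_α H|² dx. -/

import Mathlib

open MeasureTheory Real

noncomputable section

abbrev R3 : Type := Fin 3 → ℝ
abbrev C3 : Type := Fin 3 → ℂ

/-- Partial derivative of a complex-valued function on `ℝ³`. -/
def pdC (i : Fin 3) (f : R3 → ℂ) (x : R3) : ℂ := fderiv ℝ f x (Pi.single i 1)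

/-- Partial derivative of a real-valued function on `ℝ³`. -/
def pdR (i : Fin 3) (f : R3 → ℝ) (x : R3) : ℝ := fderiv ℝ f x (Pi.single i 1)

/-- The shifted partial derivative `∂^α f/∂x_i = ∂f/∂x_i + i α_i f`. -/
def pdA (α : R3) (i : Fin 3) (f : R3 → ℂ) (x : R3) : ℂ :=
  pdC i f x + Complex.I * (α i : ℂ) * f x

/-- Componentwise partial derivative of a vector field. -/
def pdV (i : Fin 3) (F : R3 → C3) (x : R3) : C3 := fun j => pdC i (fun y => F y j) x

def realToC3 (a : R3) : C3 := fun i => (a i : ℂ)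

/-- Cross product of complex 3-vectors. -/
def crossC (a b : C3) : C3 :=
  ![a 1 * b 2 - a 2 * b 1, a 2 * b 0 - a 0 * b 2, a 0 * b 1 - a 1 * b 0]

/-- Cross product of real 3-vectors. -/
def crossR (a b : R3) : R3 :=
  ![a 1 * b 2 - a 2 * b 1, a 2 * b 0 - a 0 * b 2, a 0 * b 1 - a 1 * b 0]

/-- The unit vector `e₃ = (0,0,1)` as a complex vector. -/
def e3 : C3 := ![0, 0, 1]

/-- `ã = (a₁,a₂,−a₃)`. -/
def tld (a : R3) : R3 := ![a 0, a 1, -(a 2)]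

/-- The curl of a complex vector field on `ℝ³`. -/
def curlF (F : R3 → C3) (x : R3) : C3 :=
  ![pdC 1 (fun y => F y 2) x - pdC 2 (fun y => F y 1) x,
    pdC 2 (fun y => F y 0) x - pdC 0 (fun y => F y 2) x,
    pdC 0 (fun y => F y 1) x - pdC 1 (fun y => F y 0) x]

/-- `curl_α F = curl F + i α × F`. -/
def curlA (α : R3) (F : R3 → C3) (x : R3) : C3 :=
  curlF F x + Complex.I • crossC (realToC3 α) (F x)

/-- The divergence of a complex vector field. -/
def divFld (F : R3 → C3) (x : R3) : ℂ := ∑ i, pdC i (fun y => F y i) x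

/-- `div_α F = div F + i α · F`. -/
def divA (α : R3) (F : R3 → C3) (x : R3) : ℂ :=
  divFld F x + Complex.I * ∑ i, (α i : ℂ) * F x i

/-- Squared Euclidean norm of a complex 3-vector. -/
def nsq (v : C3) : ℝ := ∑ i, Complex.normSq (v i)

/-- `a · conj b` for complex 3-vectors. -/
def dotc (a b : C3) : ℂ := ∑ i, a i * (starRingEnd ℂ) (b i)

/-- Plain (bilinear) dot product of complex 3-vectors. -/
def dotp (a b : C3) : ℂ := ∑ i, a i * b i

/-- Componentwise complex conjugate of a vector. -/
def conjV (v : C3) : C3 := fun i => (starRingEnd ℂ) (v i)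

/-- Transverse part `(v₁, v₂, 0)` of a vector. -/
def vecT (v : C3) : C3 := ![v 0, v 1, 0]

/-- The periodicity cell `Ω = (0,2π)² × (0,h)`. -/
def Omg (h : ℝ) : Set R3 :=
  {x | x 0 ∈ Set.Ioo 0 (2 * π) ∧ x 1 ∈ Set.Ioo 0 (2 * π) ∧ x 2 ∈ Set.Ioo 0 h}

/-- The square `(0,2π)²` parametrizing the horizontal boundary faces. -/
def sq2 : Set (ℝ × ℝ) := Set.Ioo 0 (2 * π) ×ˢ Set.Ioo 0 (2 * π)

/-- The point `(p₁, p₂, t) ∈ ℝ³`. -/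
def bpt (p : ℝ × ℝ) (t : ℝ) : R3 := ![p.1, p.2, t]

/-- `2π`-periodicity in the first two variables. -/
def Biperiodic {E : Type*} (f : R3 → E) : Prop :=
  ∀ x : R3, f (x + (2 * π) • (Pi.single 0 1 : R3)) = f x ∧ f (x + (2 * π) • (Pi.single 1 1 : R3)) = f x

/-- Fourier coefficient of order `n ∈ ℤ²` of `H(·,·,t)` on the square `(0,2π)²`. -/
def fcoeff (H : R3 → C3) (n : ℤ × ℤ) (t : ℝ) : C3 := fun j =>
  (1 / (4 * (π : ℂ) ^ 2)) *
    ∫ p in sq2, H (bpt p t) j *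
      Complex.exp (-Complex.I * (((n.1 : ℝ) * p.1 + (n.2 : ℝ) * p.2 : ℝ) : ℂ))

/-- `β_n = √(k²−|n+α|²)` if `k² ≥ |n+α|²`, and `i √(|n+α|²−k²)` otherwise. -/
def betaN (k : ℝ) (α : R3) (n : ℤ × ℤ) : ℂ :=
  if ((n.1 : ℝ) + α 0) ^ 2 + ((n.2 : ℝ) + α 1) ^ 2 ≤ k ^ 2 then
    ((Real.sqrt (k ^ 2 - (((n.1 : ℝ) + α 0) ^ 2 + ((n.2 : ℝ) + α 1) ^ 2)) : ℝ) : ℂ)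
  else
    Complex.I * ((Real.sqrt ((((n.1 : ℝ) + α 0) ^ 2 + ((n.2 : ℝ) + α 1) ^ 2) - k ^ 2) : ℝ) : ℂ)

/-- The exterior Dirichlet-to-Neumann operator `T_α` applied to the `j`-th component of
the trace of `H` on `Γ_h`, evaluated at the boundary point `(p₁,p₂,h)`. -/
def Talpha (k : ℝ) (α : R3) (H : R3 → C3) (h : ℝ) (j : Fin 3) (p : ℝ × ℝ) : ℂ :=
  ∑' n : ℤ × ℤ, Complex.I * betaN k α n * fcoeff H n h j *
    Complex.exp (Complex.I * (((n.1 : ℝ) * p.1 + (n.2 : ℝ) * p.2 : ℝ) : ℂ))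

/-- Standing hypotheses on `ε_r⁻¹`: `C¹`, biperiodic, positive and bounded away from
zero, and equal to `1` near `Γ_h`. -/
structure EpsOK (h : ℝ) (εinv : R3 → ℝ) : Prop where
  smooth : ContDiff ℝ 1 εinv
  periodic : Biperiodic εinv
  pos : ∃ c : ℝ, 0 < c ∧ ∀ x, c ≤ εinv x
  one_near_top : ∃ η : ℝ, 0 < η ∧ η < h ∧ ∀ x : R3, h - η < x 2 → εinv x = 1

/-- A homogeneous radiating solution of the biperiodic scattering problem. -/
structure IsHomSol (h k : ℝ) (α : R3) (εinv : R3 → ℝ) (H : R3 → C3) : Prop where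
  smooth : ContDiff ℝ 2 H
  periodic : Biperiodic H
  maxwell : ∀ x ∈ Omg h, curlA α (fun y => (εinv y : ℂ) • curlA α H y) x = (k ^ 2 : ℂ) • H x
  divfree : ∀ x ∈ Omg h, divA α H x = 0
  bc_normal : ∀ x : R3, x 2 = 0 → H x 2 = 0
  bc_tangential : ∀ x : R3, x 2 = 0 → crossC e3 ((εinv x : ℂ) • curlA α H x) = 0
  radiation : ∀ n : ℤ × ℤ, ∀ j : Fin 3,
    deriv (fun t => fcoeff H n t j) h = Complex.I * betaN k α n * fcoeff H n h j

/-- The non-trapping assumptions (a), (b), (c) on `ε_r⁻¹`. -/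
def NonTrapping (h : ℝ) (εinv : R3 → ℝ) : Prop :=
  (∀ x ∈ Omg h, pdR 2 εinv x ≤ 0) ∧
  (∃ U : Set R3, IsOpen U ∧ U.Nonempty ∧ U ⊆ Omg h ∧ ∀ x ∈ U, pdR 2 εinv x < 0) ∧
  (∃ δ : ℝ, 1 / 2 < δ ∧ ∃ Mt Mz : ℝ,
    (∀ x ∈ Omg h, (pdR 0 εinv x) ^ 2 + (pdR 1 εinv x) ^ 2 ≤ Mt ^ 2) ∧
    (∀ x ∈ Omg h, |pdR 2 εinv x| ≤ Mz) ∧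
    δ / 2 * Mt ^ 2 + Real.sqrt 2 / h * Mz < 2 / h ^ 2)

/-- The closed cell `[0,2π]² × [0,h]`. -/
def cell (h : ℝ) : Set R3 := Set.Icc 0 ![2 * π, 2 * π, h]

lemma Omg_eq (h : ℝ) :
    Omg h = Set.pi Set.univ fun i => Set.Ioo ((0 : R3) i) ((![2 * π, 2 * π, h] : R3) i) := by
  ext x
  simp [Omg, Set.mem_pi, Fin.forall_fin_succ]

lemma Omg_ae_eq_cell (h : ℝ) : Omg h =ᵐ[volume] cell h := by
  rw [Omg_eq]
  exact Measure.univ_pi_Ioo_ae_eq_Icc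

lemma Omg_subset_cell (h : ℝ) : Omg h ⊆ cell h := by
  intro x hx
  simp only [cell, Set.mem_Icc, Pi.le_def, Fin.forall_fin_succ]
  obtain ⟨⟨a, b⟩, ⟨c, d⟩, e, f⟩ := hx
  simp [a.le, b.le, c.le, d.le, e.le, f.le]

lemma measurableSet_Omg (h : ℝ) : MeasurableSet (Omg h) := by
  rw [Omg_eq]
  exact MeasurableSet.univ_pi fun _ => measurableSet_Ioo

lemma ContinuousOn.integrableOn_Omg {E : Type*} [NormedAddCommGroup E] {h : ℝ} {f : R3 → E}
    (hf : ContinuousOn f (cell h)) : IntegrableOn f (Omg h) :=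
  (hf.integrableOn_compact isCompact_Icc).mono_set (Omg_subset_cell h)

lemma Continuous.integrableOn_Omg {E : Type*} [NormedAddCommGroup E] {f : R3 → E}
    (hf : Continuous f) (h : ℝ) : IntegrableOn f (Omg h) :=
  hf.continuousOn.integrableOn_Omg

lemma sq2_ae_eq : sq2 =ᵐ[volume] (Set.Icc 0 (2 * π, 2 * π) : Set (ℝ × ℝ)) := by
  rw [sq2, ← Prod.mk_zero_zero, ← Set.Icc_prod_Icc, Measure.volume_eq_prod]
  exact Measure.set_prod_ae_eq Ioo_ae_eq_Icc Ioo_ae_eq_Icc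

lemma measurableSet_sq2 : MeasurableSet sq2 := measurableSet_Ioo.prod measurableSet_Ioo

lemma sq2_subset : sq2 ⊆ (Set.Icc 0 (2 * π, 2 * π) : Set (ℝ × ℝ)) := by
  rw [sq2, ← Prod.mk_zero_zero, ← Set.Icc_prod_Icc]
  exact Set.prod_mono Set.Ioo_subset_Icc_self Set.Ioo_subset_Icc_self

lemma Continuous.integrableOn_sq2 {E : Type*} [NormedAddCommGroup E] {f : ℝ × ℝ → E}
    (hf : Continuous f) : IntegrableOn f sq2 :=
  (hf.continuousOn.integrableOn_compact isCompact_Icc).mono_set sq2_subset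

lemma continuous_bpt (t : ℝ) : Continuous fun p : ℝ × ℝ => bpt p t := by
  unfold bpt
  refine continuous_pi fun i => ?_
  fin_cases i <;> simp <;> fun_prop

/-- The integral of a partial derivative over the cell is the difference of two face integrals. -/
lemma integral_fderiv_single {E : Type*} [NormedAddCommGroup E] [NormedSpace ℝ E] [CompleteSpace E]
    {h : ℝ} (hh : 0 < h) (V : R3 → E) (hV : ∀ x ∈ cell h, ContDiffAt ℝ 1 V x) (i : Fin 3) :
    ∫ x in Omg h, fderiv ℝ V x (Pi.single i 1) =
      (∫ y in Set.Icc ((0 : R3) ∘ i.succAbove) ((![2 * π, 2 * π, h] : R3) ∘ i.succAbove),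
        V (i.insertNth ((![2 * π, 2 * π, h] : R3) i) y)) -
      ∫ y in Set.Icc ((0 : R3) ∘ i.succAbove) ((![2 * π, 2 * π, h] : R3) ∘ i.succAbove),
        V (i.insertNth ((0 : R3) i) y) := by
  have hc : ContinuousOn V (cell h) := fun x hx => (hV x hx).continuousAt.continuousWithinAt
  have hd : ContinuousOn (fun x => fderiv ℝ V x (Pi.single i 1)) (cell h) := fun x hx =>
    (((hV x hx).fderiv_right (m := 0) le_rfl).continuousAt.clm_apply
      continuousAt_const).continuousWithinAt
  have hle : (0 : R3) ≤ ![2 * π, 2 * π, h] := by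
    simp [Pi.le_def, Fin.forall_fin_succ, hh.le, Real.pi_pos.le]
  have key := integral_divergence_of_hasFDerivAt_off_countable' (0 : R3) ![2 * π, 2 * π, h] hle
    (fun j => if j = i then V else 0) (fun j => if j = i then fderiv ℝ V else 0) ∅
    Set.countable_empty ?_ ?_ ?_
  · rw [setIntegral_congr_set (Omg_ae_eq_cell h)]
    rw [Finset.sum_eq_single i (by intro j _ hj; simp [hj]) (by simp)] at key
    simpa [cell, ite_apply, apply_ite, Finset.sum_ite_eq'] using key
  · intro j
    split_ifs
    · exact hc
    · exact continuousOn_const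
  · intro x hx j
    have hx' : x ∈ cell h := Omg_subset_cell h (by rw [Omg_eq]; exact hx.1)
    by_cases hj : j = i
    · simpa [hj] using ((hV x hx').differentiableAt one_ne_zero).hasFDerivAt
    · rw [if_neg hj, if_neg hj]
      exact hasFDerivAt_const (0 : E) x
  · refine ContinuousOn.integrableOn_compact isCompact_Icc (hd.congr fun x _ => ?_)
    simp [ite_apply, apply_ite, Finset.sum_ite_eq']

lemma Biperiodic.apply_update {E : Type*} {f : R3 → E} (hf : Biperiodic f) (x y z : ℝ) :
    f ![x + 2 * π, y, z] = f ![x, y, z] ∧ f ![x, y + 2 * π, z] = f ![x, y, z] := by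
  obtain ⟨h1, h2⟩ := hf ![x, y, z]
  constructor
  · rw [← h1]; congr 1; ext i; fin_cases i <;> simp
  · rw [← h2]; congr 1; ext i; fin_cases i <;> simp

lemma integral_fderiv_horizontal {E : Type*} [NormedAddCommGroup E] [NormedSpace ℝ E]
    [CompleteSpace E] {h : ℝ} (hh : 0 < h) {V : R3 → E} (hV : ContDiff ℝ 1 V)
    (hp : Biperiodic V) {i : Fin 3} (hi : i ≠ 2) :
    ∫ x in Omg h, fderiv ℝ V x (Pi.single i 1) = 0 := by
  rw [integral_fderiv_single hh V (fun x _ => hV.contDiffAt) i, sub_eq_zero]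
  congr 1
  ext y
  have h0 : i = 0 ∨ i = 1 := by fin_cases i <;> simp_all
  rcases h0 with rfl | rfl
  · have := (hp.apply_update 0 (y 0) (y 1)).1
    convert! this using 2 <;> ext j <;> fin_cases j <;> simp [Fin.insertNth_apply_same] <;> rfl
  · have := (hp.apply_update (y 0) 0 (y 1)).2
    convert! this using 2 <;> ext j <;> fin_cases j <;> simp [Fin.insertNth_apply_same] <;> rfl

lemma integral_fderiv_vertical {E : Type*} [NormedAddCommGroup E] [NormedSpace ℝ E]
    [CompleteSpace E] {h : ℝ} (hh : 0 < h) (V : R3 → E)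
    (hV : ∀ x ∈ cell h, ContDiffAt ℝ 1 V x) :
    ∫ x in Omg h, fderiv ℝ V x (Pi.single 2 1) =
      (∫ p in sq2, V (bpt p h)) - ∫ p in sq2, V (bpt p 0) := by
  have face : ∀ t : ℝ,
      ∫ y in Set.Icc ((0 : R3) ∘ Fin.succAbove 2) ((![2 * π, 2 * π, h] : R3) ∘ Fin.succAbove 2),
        V (Fin.insertNth (α := fun _ => ℝ) 2 t y) = ∫ p in sq2, V (bpt p t) := by
    intro t
    rw [setIntegral_congr_set sq2_ae_eq]
    rw [← ((volume_preserving_finTwoArrow ℝ).setIntegral_preimage_emb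
      (MeasurableEquiv.measurableEmbedding _))]
    congr 1
    · congr 1
      ext y
      simp [Pi.le_def, Prod.le_def, Fin.forall_fin_two, MeasurableEquiv.finTwoArrow]
      intros
      exact Iff.rfl
    · ext y
      congr 1
      ext j
      fin_cases j <;> simp [bpt, MeasurableEquiv.finTwoArrow] <;> rfl
  rw [integral_fderiv_single hh V hV 2, face, face]
  rfl

/-- Fourier coefficient of order `n` of the scalar function `u(·,·,t)` on the square. -/
def fourierSq (u : R3 → ℂ) (t : ℝ) (n : ℤ × ℤ) : ℂ :=
  (1 / (4 * (π : ℂ) ^ 2)) *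
    ∫ p in sq2, u (bpt p t) *
      Complex.exp (-Complex.I * (((n.1 : ℝ) * p.1 + (n.2 : ℝ) * p.2 : ℝ) : ℂ))

local instance : MeasureSpace UnitAddCircle := ⟨AddCircle.haarAddCircle⟩

local instance : IsProbabilityMeasure (volume : Measure UnitAddCircle) :=
  inferInstanceAs (IsProbabilityMeasure AddCircle.haarAddCircle)

open scoped Pointwise in
lemma integral_unit_square_scale (G : ℝ × ℝ → ℂ) :
    ∫ x in {x : Fin 2 → ℝ | ∀ i, x i ∈ Set.Ioc ((0 : Fin 2 → ℝ) i) ((0 : Fin 2 → ℝ) i + 1)},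
      G (2 * π * x 0, 2 * π * x 1) = (1 / (4 * (π : ℂ) ^ 2)) * ∫ p in sq2, G p := by
  have e1 : ∫ x in {x : Fin 2 → ℝ | ∀ i, x i ∈ Set.Ioc ((0 : Fin 2 → ℝ) i) ((0 : Fin 2 → ℝ) i + 1)},
      G (2 * π * x 0, 2 * π * x 1) =
      ∫ p in Set.Ioc (0 : ℝ) 1 ×ˢ Set.Ioc (0 : ℝ) 1, G ((2 * π) • p) := by
    rw [← ((volume_preserving_finTwoArrow ℝ).setIntegral_preimage_emb
      (MeasurableEquiv.measurableEmbedding _))]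
    congr 1
    congr 1
    ext y
    simp [Fin.forall_fin_two, MeasurableEquiv.finTwoArrow]
  have e2 : (Set.Ioc (0 : ℝ) 1 ×ˢ Set.Ioc (0 : ℝ) 1 : Set (ℝ × ℝ)) =ᵐ[volume]
      (Set.Ioo (0 : ℝ) 1 ×ˢ Set.Ioo (0 : ℝ) 1 : Set (ℝ × ℝ)) := by
    rw [Measure.volume_eq_prod]
    exact Measure.set_prod_ae_eq Ioo_ae_eq_Ioc.symm Ioo_ae_eq_Ioc.symm
  have e3 : (2 * π) • (Set.Ioo (0 : ℝ) 1 ×ˢ Set.Ioo (0 : ℝ) 1 : Set (ℝ × ℝ)) = sq2 := by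
    have hp := Real.two_pi_pos
    ext p
    rw [Set.mem_smul_set_iff_inv_smul_mem₀ hp.ne']
    simp only [sq2, Set.mem_prod, Set.mem_Ioo, Prod.smul_fst, Prod.smul_snd, smul_eq_mul,
      ← div_eq_inv_mul, div_lt_one hp, div_pos_iff_of_pos_right hp]
  rw [e1, setIntegral_congr_set e2, Measure.setIntegral_comp_smul_of_pos _ _ _ Real.two_pi_pos, e3]
  simp
  left
  ring

lemma memLp_torus {U : ℝ × ℝ → ℂ} (hU : Continuous U) :
    MemLp (fun x : UnitAddTorus (Fin 2) => U (2 * π * (AddCircle.equivIoc 1 0 (x 0)).1,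
      2 * π * (AddCircle.equivIoc 1 0 (x 1)).1)) 2 volume := by
  have hm : ∀ i : Fin 2, Measurable fun x : UnitAddTorus (Fin 2) =>
      ((AddCircle.equivIoc 1 0 (x i)).1 : ℝ) := fun i =>
    measurable_subtype_coe.comp
      ((AddCircle.measurableEquivIoc 1 0).measurable.comp (measurable_pi_apply i))
  obtain ⟨C, hC⟩ :=
    (isCompact_Icc (a := (0 : ℝ × ℝ)) (b := (2 * π, 2 * π))).exists_bound_of_continuousOn
    hU.continuousOn
  refine MemLp.of_bound (C := C) ?_ (Filter.Eventually.of_forall fun x => hC _ ?_)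
  · exact (hU.measurable.comp (((hm 0).const_mul _).prodMk ((hm 1).const_mul _))).aestronglyMeasurable
  · have h0 := (AddCircle.equivIoc (1 : ℝ) 0 (x 0)).2
    have h1 := (AddCircle.equivIoc (1 : ℝ) 0 (x 1)).2
    have hp := Real.two_pi_pos
    simp only [zero_add, Set.mem_Ioc] at h0 h1
    simp only [Set.mem_Icc, Prod.le_def]
    refine ⟨⟨?_, ?_⟩, ?_, ?_⟩ <;> (try simp only [Prod.fst_zero, Prod.snd_zero]) <;> nlinarith

lemma integral_torus (G : UnitAddTorus (Fin 2) → ℂ) (F : ℝ × ℝ → ℂ)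
    (hGF : ∀ x : Fin 2 → ℝ, (∀ i, x i ∈ Set.Ioc (0 : ℝ) 1) →
      G (fun i => (x i : UnitAddCircle)) = F (2 * π * x 0, 2 * π * x 1)) :
    ∫ x, G x = (1 / (4 * (π : ℂ) ^ 2)) * ∫ p in sq2, F p := by
  rw [← integral_unit_square_scale, UnitAddTorus.integral_preimage G 0]
  refine setIntegral_congr_fun ?_ fun x hx => hGF x (by simpa using hx)
  have : {x : Fin 2 → ℝ | ∀ i, x i ∈ Set.Ioc ((0 : Fin 2 → ℝ) i) ((0 : Fin 2 → ℝ) i + 1)} =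
      Set.pi Set.univ fun i => Set.Ioc ((0 : Fin 2 → ℝ) i) ((0 : Fin 2 → ℝ) i + 1) := by
    ext; simp
  rw [this]
  exact MeasurableSet.univ_pi fun _ => measurableSet_Ioc

lemma equivIoc_coe {x : ℝ} (hx : x ∈ Set.Ioc (0 : ℝ) 1) :
    (AddCircle.equivIoc (1 : ℝ) 0 (x : UnitAddCircle)).1 = x :=
  AddCircle.equivIoc_coe_of_mem (by simpa using hx)

/-- **Parseval's identity** on the square. -/
lemma hasSum_fourierSq {u v : R3 → ℂ} (hu : Continuous u) (hv : Continuous v) (t : ℝ) :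
    HasSum (fun n => fourierSq u t n * (starRingEnd ℂ) (fourierSq v t n))
      ((1 / (4 * (π : ℂ) ^ 2)) * ∫ p in sq2, u (bpt p t) * (starRingEnd ℂ) (v (bpt p t))) := by
  have hu' : Continuous fun p => u (bpt p t) := hu.comp (continuous_bpt t)
  have hv' : Continuous fun p => v (bpt p t) := hv.comp (continuous_bpt t)
  have key := UnitAddTorus.hasSum_prod_mFourierCoeff (memLp_torus hv').toLp (memLp_torus hu').toLp
  have hcoef : ∀ {w : R3 → ℂ} (hw : Continuous fun p => w (bpt p t)) (n : Fin 2 → ℤ),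
      UnitAddTorus.mFourierCoeff (memLp_torus hw).toLp n = fourierSq w t (n 0, n 1) := by
    intro w hw n
    rw [UnitAddTorus.mFourierCoeff, integral_congr_ae
      (g := fun x => UnitAddTorus.mFourier (-n) x • (w (bpt (2 * π * (AddCircle.equivIoc 1 0 (x 0)).1,
      2 * π * (AddCircle.equivIoc 1 0 (x 1)).1) t))), fourierSq]
    · apply integral_torus
      intro x hx
      simp only [equivIoc_coe (hx _), UnitAddTorus.mFourier, ContinuousMap.coe_mk, Fin.prod_univ_two,
        fourier_coe_apply, smul_eq_mul, ← Complex.exp_add]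
      rw [mul_comm]
      congr 2
      simp
      ring
    · filter_upwards [(memLp_torus hw).coeFn_toLp] with x hx
      rw [hx]
  have e : ∫ x, (starRingEnd ℂ) ((memLp_torus hv').toLp _ x) * (memLp_torus hu').toLp _ x =
      (1 / (4 * (π : ℂ) ^ 2)) * ∫ p in sq2, u (bpt p t) * (starRingEnd ℂ) (v (bpt p t)) := by
    rw [integral_congr_ae (g := fun x => (starRingEnd ℂ) (v (bpt
      (2 * π * (AddCircle.equivIoc 1 0 (x 0)).1, 2 * π * (AddCircle.equivIoc 1 0 (x 1)).1) t)) *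
      u (bpt (2 * π * (AddCircle.equivIoc 1 0 (x 0)).1, 2 * π * (AddCircle.equivIoc 1 0 (x 1)).1) t))]
    · apply integral_torus (F := fun p => u (bpt p t) * (starRingEnd ℂ) (v (bpt p t)))
      intro x hx
      simp only [equivIoc_coe (hx _)]
      rw [mul_comm]
    · filter_upwards [(memLp_torus hv').coeFn_toLp, (memLp_torus hu').coeFn_toLp] with x h1 h2
      rw [h1, h2]
  rw [e] at key
  rw [← (finTwoArrowEquiv ℤ).hasSum_iff]
  convert key using 2 with n
  rw [hcoef hv', hcoef hu', mul_comm]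
  rfl

section PartialDerivatives

variable {α : R3} {i : Fin 3} {f g : R3 → ℂ} {x : R3}

lemma pdC_conj : pdC i (fun y => (starRingEnd ℂ) (f y)) x = (starRingEnd ℂ) (pdC i f x) := by
  have : (fun y => (starRingEnd ℂ) (f y)) = Complex.conjCLE ∘ f := by
    ext y; simp
  rw [pdC, this, ContinuousLinearEquiv.comp_fderiv]
  simp [pdC]

lemma pdC_mul (hf : DifferentiableAt ℝ f x) (hg : DifferentiableAt ℝ g x) :
    pdC i (fun y => f y * g y) x = pdC i f x * g x + f x * pdC i g x := by
  rw [pdC, fderiv_fun_mul hf hg]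
  simp [pdC]
  ring

lemma DifferentiableAt.conj_comp (hf : DifferentiableAt ℝ f x) :
    DifferentiableAt ℝ (fun y => (starRingEnd ℂ) (f y)) x :=
  Complex.conjCLE.differentiableAt.comp x hf

/-- Shifted product rule: the phase shifts cancel in `f * conj g`. -/
lemma pdC_mul_conj (hf : DifferentiableAt ℝ f x) (hg : DifferentiableAt ℝ g x) :
    pdC i (fun y => f y * (starRingEnd ℂ) (g y)) x =
      pdA α i f x * (starRingEnd ℂ) (g x) + f x * (starRingEnd ℂ) (pdA α i g x) := by
  rw [pdC_mul hf hg.conj_comp, pdC_conj]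
  simp [pdA]
  ring

lemma pdC_add (hf : DifferentiableAt ℝ f x) (hg : DifferentiableAt ℝ g x) :
    pdC i (fun y => f y + g y) x = pdC i f x + pdC i g x := by
  rw [pdC, fderiv_fun_add hf hg]
  rfl

lemma pdC_sub (hf : DifferentiableAt ℝ f x) (hg : DifferentiableAt ℝ g x) :
    pdC i (fun y => f y - g y) x = pdC i f x - pdC i g x := by
  rw [pdC, fderiv_fun_sub hf hg]
  rfl

lemma pdC_const_mul (c : ℂ) (hf : DifferentiableAt ℝ f x) :
    pdC i (fun y => c * f y) x = c * pdC i f x := by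
  rw [pdC, fderiv_const_mul hf]
  rfl

lemma pdC_ofReal {r : R3 → ℝ} (hr : DifferentiableAt ℝ r x) :
    pdC i (fun y => (r y : ℂ)) x = (pdR i r x : ℂ) := by
  have := (Complex.ofRealCLM.hasFDerivAt.comp x hr.hasFDerivAt).fderiv
  rw [pdC, show (fun y => (r y : ℂ)) = Complex.ofRealCLM ∘ r from rfl, this]
  rfl

lemma pdC_ofReal_mul {r : R3 → ℝ} (hr : DifferentiableAt ℝ r x) (hf : DifferentiableAt ℝ f x) :
    pdC i (fun y => (r y : ℂ) * f y) x = r x * pdC i f x + pdR i r x * f x := by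
  have hr' : DifferentiableAt ℝ (fun y => (r y : ℂ)) x :=
    Complex.ofRealCLM.differentiableAt.comp x hr
  rw [pdC_mul hr' hf, pdC_ofReal hr]
  ring

lemma pdA_add (hf : DifferentiableAt ℝ f x) (hg : DifferentiableAt ℝ g x) :
    pdA α i (fun y => f y + g y) x = pdA α i f x + pdA α i g x := by
  simp only [pdA, pdC_add hf hg]
  ring

lemma pdA_sub (hf : DifferentiableAt ℝ f x) (hg : DifferentiableAt ℝ g x) :
    pdA α i (fun y => f y - g y) x = pdA α i f x - pdA α i g x := by
  simp only [pdA, pdC_sub hf hg]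
  ring

lemma pdA_ofReal_mul {r : R3 → ℝ} (hr : DifferentiableAt ℝ r x) (hf : DifferentiableAt ℝ f x) :
    pdA α i (fun y => (r y : ℂ) * f y) x = r x * pdA α i f x + pdR i r x * f x := by
  simp only [pdA, pdC_ofReal_mul hr hf]
  ring

lemma pdR_coord (j : Fin 3) : pdR i (fun y => y j) x = if i = j then 1 else 0 := by
  rw [pdR, (hasFDerivAt_apply j x).fderiv]
  simp [Pi.single_apply, eq_comm]

lemma ContDiff.pdC {n : WithTop ℕ∞} (hf : ContDiff ℝ (n + 1) f) : ContDiff ℝ n (pdC i f) :=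
  (hf.fderiv_right le_rfl).clm_apply contDiff_const

lemma ContDiff.pdA {n : WithTop ℕ∞} (hf : ContDiff ℝ (n + 1) f) : ContDiff ℝ n (pdA α i f) :=
  hf.pdC.add (contDiff_const.mul (hf.of_le le_self_add))

lemma ContDiff.pdR {n : WithTop ℕ∞} {r : R3 → ℝ} (hr : ContDiff ℝ (n + 1) r) :
    ContDiff ℝ n (pdR i r) :=
  (hr.fderiv_right le_rfl).clm_apply contDiff_const

lemma pdC_comm {j : Fin 3} (hf : ContDiff ℝ 2 f) : pdC i (pdC j f) x = pdC j (pdC i f) x := by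
  have hd : DifferentiableAt ℝ (fderiv ℝ f) x :=
    (hf.fderiv_right (m := 1) (by norm_num)).differentiable one_ne_zero x
  have hs : IsSymmSndFDerivAt ℝ f x := hf.contDiffAt.isSymmSndFDerivAt (by simp)
  have e : ∀ a b : Fin 3, pdC a (pdC b f) x =
      fderiv ℝ (fderiv ℝ f) x (Pi.single a 1) (Pi.single b 1) := by
    intro a b
    change fderiv ℝ (fun y => fderiv ℝ f y (Pi.single b 1)) x (Pi.single a 1) = _
    rw [fderiv_clm_apply hd (differentiableAt_const _)]
    simp
  rw [e, e, hs.eq]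

lemma pdA_comm {j : Fin 3} (hf : ContDiff ℝ 2 f) :
    pdA α i (pdA α j f) x = pdA α j (pdA α i f) x := by
  have hd : Differentiable ℝ f := hf.differentiable two_ne_zero
  have h1 : ∀ a : Fin 3, Differentiable ℝ (pdC a f) := fun a =>
    (ContDiff.pdC (n := 1) (by rwa [one_add_one_eq_two])).differentiable one_ne_zero
  have e : ∀ a b : Fin 3, pdA α a (pdA α b f) x = pdC a (pdC b f) x +
      Complex.I * α b * pdC a f x + Complex.I * α a * (pdC b f x + Complex.I * α b * f x) := by
    intro a b
    rw [pdA, show pdA α b f = fun y => pdC b f y + Complex.I * α b * f y from rfl,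
      pdC_add (h1 b x) ((hd x).const_mul _), pdC_const_mul _ (hd x)]
  rw [e, e, pdC_comm hf]
  ring

lemma Biperiodic.fderiv {E : Type*} [NormedAddCommGroup E] [NormedSpace ℝ E] {F : R3 → E}
    (hF : Biperiodic F) : Biperiodic (fderiv ℝ F) := by
  intro y
  constructor
  · rw [← fderiv_comp_add_right]
    exact congrArg (fun G => _root_.fderiv ℝ G y) (funext fun z => (hF z).1)
  · rw [← fderiv_comp_add_right]
    exact congrArg (fun G => _root_.fderiv ℝ G y) (funext fun z => (hF z).2)

lemma Biperiodic.comp {E F : Type*} {u : R3 → E} (hu : Biperiodic u) (φ : E → F) :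
    Biperiodic fun y => φ (u y) :=
  fun y => ⟨congrArg φ (hu y).1, congrArg φ (hu y).2⟩

lemma Biperiodic.comp₂ {E F G : Type*} {u : R3 → E} {v : R3 → F} (hu : Biperiodic u)
    (hv : Biperiodic v) (φ : E → F → G) : Biperiodic fun y => φ (u y) (v y) := by
  intro y
  simp only [(hu y).1, (hu y).2, (hv y).1, (hv y).2, and_self]

lemma Biperiodic.pdC (hf : Biperiodic f) : Biperiodic (pdC i f) :=
  hf.fderiv.comp fun L => L (Pi.single i 1)

lemma Biperiodic.pdA (hf : Biperiodic f) : Biperiodic (pdA α i f) :=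
  hf.pdC.comp₂ hf fun a b => a + Complex.I * (α i : ℂ) * b

end PartialDerivatives

lemma curlA_zero (α : R3) (F : R3 → C3) (x : R3) :
    curlA α F x 0 = pdA α 1 (fun y => F y 2) x - pdA α 2 (fun y => F y 1) x := by
  simp [curlA, curlF, crossC, realToC3, pdA]
  ring

lemma curlA_one (α : R3) (F : R3 → C3) (x : R3) :
    curlA α F x 1 = pdA α 2 (fun y => F y 0) x - pdA α 0 (fun y => F y 2) x := by
  simp [curlA, curlF, crossC, realToC3, pdA]
  ring

lemma curlA_two (α : R3) (F : R3 → C3) (x : R3) :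
    curlA α F x 2 = pdA α 0 (fun y => F y 1) x - pdA α 1 (fun y => F y 0) x := by
  simp [curlA, curlF, crossC, realToC3, pdA]
  ring

lemma divA_eq (α : R3) (F : R3 → C3) (x : R3) :
    divA α F x = pdA α 0 (fun y => F y 0) x + pdA α 1 (fun y => F y 1) x +
      pdA α 2 (fun y => F y 2) x := by
  simp [divA, divFld, Fin.sum_univ_three, pdA]
  ring

/-- The divergence theorem on the cell for a biperiodic `C¹` field. -/
lemma integral_divergence_Omg {h : ℝ} (hh : 0 < h) (F : Fin 3 → R3 → ℂ)
    (hF : ∀ i, ContDiff ℝ 1 (F i)) (hp : ∀ i, Biperiodic (F i)) :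
    ∫ x in Omg h, ∑ i, pdC i (F i) x =
      (∫ p in sq2, F 2 (bpt p h)) - ∫ p in sq2, F 2 (bpt p 0) := by
  have hint : ∀ i, IntegrableOn (pdC i (F i)) (Omg h) := fun i =>
    (ContDiff.pdC (n := 0) (by simpa using hF i)).continuous.integrableOn_Omg h
  rw [integral_finsetSum _ fun i _ => hint i, Fin.sum_univ_three]
  have h0 : ∫ x in Omg h, pdC 0 (F 0) x = 0 :=
    integral_fderiv_horizontal hh (hF 0) (hp 0) (by decide)
  have h1 : ∫ x in Omg h, pdC 1 (F 1) x = 0 :=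
    integral_fderiv_horizontal hh (hF 1) (hp 1) (by decide)
  have h2 : ∫ x in Omg h, pdC 2 (F 2) x = _ :=
    integral_fderiv_vertical hh (F 2) fun x _ => (hF 2).contDiffAt
  rw [h0, h1, h2]
  ring

section FourierDerivatives

variable {u v : R3 → ℂ}

lemma integral_sq2_pdC_horizontal {G : R3 → ℂ} (hG : ContDiff ℝ 1 G) (hp : Biperiodic G) (t : ℝ) :
    (∫ p in sq2, pdC 0 G (bpt p t)) = 0 ∧ (∫ p in sq2, pdC 1 G (bpt p t)) = 0 := by
  let L : ℝ × ℝ →L[ℝ] R3 := ContinuousLinearMap.pi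
    ![ContinuousLinearMap.fst ℝ ℝ ℝ, ContinuousLinearMap.snd ℝ ℝ ℝ, 0]
  have hL : ∀ p, HasFDerivAt (fun p => bpt p t) L p := by
    intro p
    refine hasFDerivAt_pi.2 fun i => ?_
    fin_cases i
    · exact hasFDerivAt_fst
    · exact hasFDerivAt_snd
    · exact hasFDerivAt_const _ _
  have hL0 : L (1, 0) = Pi.single 0 1 := by
    ext i; fin_cases i <;> simp [L]
  have hL1 : L (0, 1) = Pi.single 1 1 := by
    ext i; fin_cases i <;> simp [L]
  have hd : ∀ p, HasFDerivAt (fun p => G (bpt p t)) ((fderiv ℝ G (bpt p t)).comp L) p := fun p =>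
    (hG.differentiable one_ne_zero _).hasFDerivAt.comp p (hL p)
  have hc : Continuous fun p => G (bpt p t) := hG.continuous.comp (continuous_bpt t)
  have hint : ∀ i, IntegrableOn (fun p => pdC i G (bpt p t))
      (Set.Icc (0 : ℝ × ℝ) (2 * π, 2 * π)) := fun i =>
    ((ContDiff.pdC (n := 0) (by simpa using hG)).continuous.comp
      (continuous_bpt t)).continuousOn.integrableOn_compact isCompact_Icc
  have hle : (0 : ℝ × ℝ) ≤ (2 * π, 2 * π) := ⟨Real.two_pi_pos.le, Real.two_pi_pos.le⟩
  have per0 : ∀ y, G (bpt (2 * π, y) t) = G (bpt (0, y) t) := fun y => by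
    simpa [bpt] using (hp.apply_update 0 y t).1
  have per1 : ∀ y, G (bpt (y, 2 * π) t) = G (bpt (y, 0) t) := fun y => by
    simpa [bpt] using (hp.apply_update y 0 t).2
  constructor
  · have := integral_divergence_prod_Icc_of_hasFDerivAt_of_le (fun p => G (bpt p t)) 0
      (fun p => (fderiv ℝ G (bpt p t)).comp L) 0 0 (2 * π, 2 * π) hle hc.continuousOn
      continuousOn_const (fun p _ => hd p) (fun p _ => hasFDerivAt_const _ _)
      (by simpa [hL0, pdC] using hint 0)
    rw [setIntegral_congr_set sq2_ae_eq]
    simpa [hL0, per0, pdC] using this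
  · have := integral_divergence_prod_Icc_of_hasFDerivAt_of_le 0 (fun p => G (bpt p t))
      0 (fun p => (fderiv ℝ G (bpt p t)).comp L) 0 (2 * π, 2 * π) hle continuousOn_const
      hc.continuousOn (fun p _ => hasFDerivAt_const _ _) (fun p _ => hd p)
      (by simpa [hL1, pdC] using hint 1)
    rw [setIntegral_congr_set sq2_ae_eq]
    simpa [hL1, per1, pdC] using this

/-- The conjugate Fourier mode `exp(-i n·x)`, as a function on `ℝ³`. -/
def expMode (n : ℤ × ℤ) (x : R3) : ℂ :=
  Complex.exp (-Complex.I * (((n.1 : ℝ) * x 0 + (n.2 : ℝ) * x 1 : ℝ) : ℂ))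

lemma contDiff_expMode (n : ℤ × ℤ) : ContDiff ℝ 1 (expMode n) := by
  unfold expMode
  refine ContDiff.cexp (contDiff_const.mul (Complex.ofRealCLM.contDiff.comp
    (f := fun x : R3 => (n.1 : ℝ) * x 0 + (n.2 : ℝ) * x 1) ?_))
  fun_prop

lemma expMode_bpt (n : ℤ × ℤ) (p : ℝ × ℝ) (t : ℝ) : expMode n (bpt p t) =
    Complex.exp (-Complex.I * (((n.1 : ℝ) * p.1 + (n.2 : ℝ) * p.2 : ℝ) : ℂ)) := by
  simp [expMode, bpt]

lemma biperiodic_expMode (n : ℤ × ℤ) : Biperiodic (expMode n) := by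
  intro x
  unfold expMode
  constructor
  · rw [Complex.exp_eq_exp_iff_exists_int]
    refine ⟨-n.1, ?_⟩
    simp
    ring
  · rw [Complex.exp_eq_exp_iff_exists_int]
    refine ⟨-n.2, ?_⟩
    simp
    ring

lemma pdC_expMode (n : ℤ × ℤ) (x : R3) :
    pdC 0 (expMode n) x = -Complex.I * n.1 * expMode n x ∧
    pdC 1 (expMode n) x = -Complex.I * n.2 * expMode n x := by
  have h1 : HasFDerivAt (fun y : R3 => (n.1 : ℝ) * y 0 + (n.2 : ℝ) * y 1)
      ((n.1 : ℝ) • ContinuousLinearMap.proj (R := ℝ) (φ := fun _ : Fin 3 => ℝ) 0 +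
        (n.2 : ℝ) • ContinuousLinearMap.proj (R := ℝ) (φ := fun _ : Fin 3 => ℝ) 1) x :=
    ((hasFDerivAt_apply 0 x).const_mul _).add ((hasFDerivAt_apply 1 x).const_mul _)
  have h2 := ((Complex.ofRealCLM.hasFDerivAt.comp x h1).const_mul (-Complex.I)).cexp
  have h3 := h2.fderiv
  constructor
  · rw [pdC]
    erw [h3]
    simp [expMode]
    ring
  · rw [pdC]
    erw [h3]
    simp [expMode]
    ring

lemma fourierSq_sub (hu : Continuous u) (hv : Continuous v) (t : ℝ) (n : ℤ × ℤ) :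
    fourierSq (fun x => u x - v x) t n = fourierSq u t n - fourierSq v t n := by
  have hi : ∀ {w : R3 → ℂ}, Continuous w → IntegrableOn (fun p => w (bpt p t) *
      Complex.exp (-Complex.I * (((n.1 : ℝ) * p.1 + (n.2 : ℝ) * p.2 : ℝ) : ℂ))) sq2 := fun hw =>
    ((hw.comp (continuous_bpt t)).mul (by fun_prop)).integrableOn_sq2
  simp only [fourierSq, sub_mul]
  rw [integral_sub (hi hu) (hi hv), mul_sub]

lemma fourierSq_add (hu : Continuous u) (hv : Continuous v) (t : ℝ) (n : ℤ × ℤ) :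
    fourierSq (fun x => u x + v x) t n = fourierSq u t n + fourierSq v t n := by
  have hi : ∀ {w : R3 → ℂ}, Continuous w → IntegrableOn (fun p => w (bpt p t) *
      Complex.exp (-Complex.I * (((n.1 : ℝ) * p.1 + (n.2 : ℝ) * p.2 : ℝ) : ℂ))) sq2 := fun hw =>
    ((hw.comp (continuous_bpt t)).mul (by fun_prop)).integrableOn_sq2
  simp only [fourierSq, add_mul]
  rw [integral_add (hi hu) (hi hv), mul_add]

lemma fourierSq_const_mul (c : ℂ) (t : ℝ) (n : ℤ × ℤ) :
    fourierSq (fun x => c * u x) t n = c * fourierSq u t n := by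
  simp only [fourierSq, mul_assoc, integral_const_mul]
  ring

lemma fourierSq_pdC_horizontal (hu : ContDiff ℝ 1 u) (hp : Biperiodic u) (t : ℝ) (n : ℤ × ℤ) :
    fourierSq (pdC 0 u) t n = Complex.I * n.1 * fourierSq u t n ∧
    fourierSq (pdC 1 u) t n = Complex.I * n.2 * fourierSq u t n := by
  have hE := contDiff_expMode n
  have hz := integral_sq2_pdC_horizontal (hu.mul hE)
    (hp.comp₂ (biperiodic_expMode n) fun a b => a * b) t
  have hd := hu.differentiable one_ne_zero
  have hdE := hE.differentiable one_ne_zero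
  have hi : ∀ {w : R3 → ℂ}, Continuous w →
      IntegrableOn (fun p => w (bpt p t) * expMode n (bpt p t)) sq2 := fun hw =>
    ((hw.comp (continuous_bpt t)).mul (hE.continuous.comp (continuous_bpt t))).integrableOn_sq2
  have hcu : ∀ i, Continuous (pdC i u) := fun i =>
    (ContDiff.pdC (n := 0) (by simpa using hu)).continuous
  have e : ∀ w : R3 → ℂ, fourierSq w t n =
      (1 / (4 * (π : ℂ) ^ 2)) * ∫ p in sq2, w (bpt p t) * expMode n (bpt p t) := by
    intro w
    simp only [fourierSq, expMode_bpt]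
  have main : ∀ (i : Fin 3) (m : ℤ),
      (∀ x, pdC i (expMode n) x = -Complex.I * m * expMode n x) →
      (∫ p in sq2, pdC i (fun y => u y * expMode n y) (bpt p t)) = 0 →
      fourierSq (pdC i u) t n = Complex.I * m * fourierSq u t n := by
    intro i m hm h0
    have e2 : ∀ p, pdC i (fun y => u y * expMode n y) (bpt p t) =
        pdC i u (bpt p t) * expMode n (bpt p t) -
          Complex.I * m * (u (bpt p t) * expMode n (bpt p t)) := by
      intro p
      rw [pdC_mul (hd _) (hdE _), hm]
      ring
    simp only [e2] at h0
    rw [integral_sub (hi (hcu i)) ((hi hu.continuous).const_mul _), integral_const_mul,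
      sub_eq_zero] at h0
    rw [e, e, h0]
    ring
  exact ⟨main 0 n.1 (fun x => (pdC_expMode n x).1) hz.1,
    main 1 n.2 (fun x => (pdC_expMode n x).2) hz.2⟩

lemma fourierSq_pdA_horizontal (α : R3) (hu : ContDiff ℝ 1 u) (hp : Biperiodic u) (t : ℝ)
    (n : ℤ × ℤ) :
    fourierSq (pdA α 0 u) t n = Complex.I * ((n.1 + α 0 : ℝ) : ℂ) * fourierSq u t n ∧
    fourierSq (pdA α 1 u) t n = Complex.I * ((n.2 + α 1 : ℝ) : ℂ) * fourierSq u t n := by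
  have hcu : ∀ i, Continuous (pdC i u) := fun i =>
    (ContDiff.pdC (n := 0) (by simpa using hu)).continuous
  have e : ∀ i, fourierSq (pdA α i u) t n =
      fourierSq (pdC i u) t n + Complex.I * α i * fourierSq u t n := fun i => by
    rw [← fourierSq_const_mul, ← fourierSq_add (hcu i) (by fun_prop)]
    rfl
  obtain ⟨h0, h1⟩ := fourierSq_pdC_horizontal hu hp t n
  rw [e, e, h0, h1]
  push_cast
  exact ⟨by ring, by ring⟩

lemma hasDerivAt_fourierSq (hu : ContDiff ℝ 1 u) (t : ℝ) (n : ℤ × ℤ) :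
    HasDerivAt (fun s => fourierSq u s n) (fourierSq (pdC 2 u) t n) t := by
  have hcu : Continuous (pdC 2 u) := (ContDiff.pdC (n := 0) (by simpa using hu)).continuous
  have hb : Continuous fun q : ℝ × ℝ × ℝ => bpt q.2 q.1 := by
    unfold bpt
    refine continuous_pi fun i => ?_
    fin_cases i <;> simp <;> fun_prop
  let e : ℝ × ℝ → ℂ := fun p =>
    Complex.exp (-Complex.I * (((n.1 : ℝ) * p.1 + (n.2 : ℝ) * p.2 : ℝ) : ℂ))
  have he : Continuous e := by fun_prop
  have hF : ∀ {w : R3 → ℂ}, Continuous w → ∀ s, Continuous fun p => w (bpt p s) * e p :=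
    fun hw s => (hw.comp (continuous_bpt s)).mul he
  obtain ⟨C, hC⟩ := ((isCompact_Icc (a := t - 1) (b := t + 1)).prod
    (isCompact_Icc (a := (0 : ℝ × ℝ)) (b := (2 * π, 2 * π)))).exists_bound_of_continuousOn
    (f := fun q : ℝ × ℝ × ℝ => pdC 2 u (bpt q.2 q.1) * e q.2)
    ((hcu.comp hb).mul (he.comp continuous_snd)).continuousOn
  have := hasDerivAt_integral_of_dominated_loc_of_deriv_le (μ := volume.restrict sq2)
    (F := fun s p => u (bpt p s) * e p) (F' := fun s p => pdC 2 u (bpt p s) * e p)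
    (x₀ := t) (s := Set.Icc (t - 1) (t + 1)) (bound := fun _ => C)
    (Icc_mem_nhds (by linarith) (by linarith))
    (Filter.Eventually.of_forall fun s => (hF hu.continuous s).aestronglyMeasurable)
    (hF hu.continuous t).integrableOn_sq2
    (hF hcu t).aestronglyMeasurable
    (by
      filter_upwards [ae_restrict_mem measurableSet_sq2] with p hp s hs
      exact hC (s, p) ⟨hs, sq2_subset hp⟩)
    (continuous_const.integrableOn_sq2)
    (by
      refine Filter.Eventually.of_forall fun p s _ => ?_
      refine HasDerivAt.mul_const ?_ _
      have hl : HasDerivAt (fun s => bpt p s) (Pi.single 2 1) s := by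
        refine hasDerivAt_pi.2 fun i => ?_
        fin_cases i
        · simpa [bpt] using hasDerivAt_const s p.1
        · simpa [bpt] using hasDerivAt_const s p.2
        · simpa [bpt] using hasDerivAt_id' s
      exact (hu.differentiable one_ne_zero _).hasFDerivAt.comp_hasDerivAt s hl)
  exact this.2.const_mul _

end FourierDerivatives

section Modes

variable {k s t σ : ℝ} {a₀ a₁ a₂ : ℂ}

/-- Boundary flux of a single mode with wave vector `(s, t, β)`. -/
def modeFlux (s t : ℝ) (β a₀ a₁ a₂ : ℂ) : ℂ :=
  (Complex.I * t * a₂ - Complex.I * β * a₁) * (starRingEnd ℂ) a₁ -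
    (Complex.I * β * a₀ - Complex.I * s * a₂) * (starRingEnd ℂ) a₀

/-- Contribution of a single mode to the boundary term of the Rellich identity. -/
def modeForm (h k s t : ℝ) (β a₀ a₁ a₂ : ℂ) : ℂ :=
  (Complex.I * t * a₂ - Complex.I * β * a₁) *
      (starRingEnd ℂ) (2 * h * (Complex.I * β * a₁) + a₁) -
    (Complex.I * β * a₀ - Complex.I * s * a₂) *
      (starRingEnd ℂ) (2 * h * (Complex.I * β * a₀) + a₀) -
    2 * (a₂ * (starRingEnd ℂ) (Complex.I * β * a₂)) +
    h * ((Complex.I * t * a₂ - Complex.I * β * a₁) *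
        (starRingEnd ℂ) (Complex.I * t * a₂ - Complex.I * β * a₁) +
      (Complex.I * β * a₀ - Complex.I * s * a₂) *
        (starRingEnd ℂ) (Complex.I * β * a₀ - Complex.I * s * a₂) +
      (Complex.I * s * a₁ - Complex.I * t * a₀) *
        (starRingEnd ℂ) (Complex.I * s * a₁ - Complex.I * t * a₀) -
      k ^ 2 * (a₀ * (starRingEnd ℂ) a₀ + a₁ * (starRingEnd ℂ) a₁ + a₂ * (starRingEnd ℂ) a₂))

lemma modeFlux_im_propagating (hdiv : s * a₀ + t * a₁ + σ * a₂ = 0) :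
    (modeFlux s t σ a₀ a₁ a₂).im =
      -σ * (Complex.normSq a₀ + Complex.normSq a₁ + Complex.normSq a₂) := by
  have h1 := congrArg Complex.re hdiv
  have h2 := congrArg Complex.im hdiv
  simp [modeFlux, Complex.normSq_apply] at h1 h2 ⊢
  linear_combination a₂.re * h1 + a₂.im * h2

lemma modeForm_re_propagating (h : ℝ) (hdiv : s * a₀ + t * a₁ + σ * a₂ = 0)
    (hk : k ^ 2 = s ^ 2 + t ^ 2 + σ ^ 2) :
    (modeForm h k s t σ a₀ a₁ a₂).re = 2 * h * σ * (modeFlux s t σ a₀ a₁ a₂).im := by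
  have hk' : ((k : ℂ) ^ 2) = ((s ^ 2 + t ^ 2 + σ ^ 2 : ℝ) : ℂ) := by rw [← hk]; simp
  have h1 := congrArg Complex.re hdiv
  have h2 := congrArg Complex.im hdiv
  rw [modeForm, modeFlux, hk']
  simp [pow_two] at h1 h2 ⊢
  grind

lemma modeFlux_im_evanescent (hdiv : s * a₀ + t * a₁ + Complex.I * σ * a₂ = 0) :
    (modeFlux s t (Complex.I * σ) a₀ a₁ a₂).im = 0 := by
  have h1 := congrArg Complex.re hdiv
  have h2 := congrArg Complex.im hdiv
  simp [modeFlux] at h1 h2 ⊢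
  linear_combination a₂.re * h1 + a₂.im * h2

lemma modeForm_re_evanescent (h : ℝ) (hdiv : s * a₀ + t * a₁ + Complex.I * σ * a₂ = 0)
    (hk : k ^ 2 = s ^ 2 + t ^ 2 - σ ^ 2) :
    (modeForm h k s t (Complex.I * σ) a₀ a₁ a₂).re =
      σ * (Complex.normSq a₀ + Complex.normSq a₁ + Complex.normSq a₂) := by
  have hk' : ((k : ℂ) ^ 2) = ((s ^ 2 + t ^ 2 - σ ^ 2 : ℝ) : ℂ) := by rw [← hk]; simp
  have h1 := congrArg Complex.re hdiv
  have h2 := congrArg Complex.im hdiv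
  rw [modeForm, hk']
  simp [Complex.normSq_apply, pow_two] at h1 h2 ⊢
  grind

end Modes

lemma betaN_cases (k : ℝ) (α : R3) (n : ℤ × ℤ) : ∃ σ : ℝ, 0 ≤ σ ∧
    ((betaN k α n = σ ∧ k ^ 2 = (n.1 + α 0) ^ 2 + (n.2 + α 1) ^ 2 + σ ^ 2) ∨
      (betaN k α n = Complex.I * σ ∧ k ^ 2 = (n.1 + α 0) ^ 2 + (n.2 + α 1) ^ 2 - σ ^ 2)) := by
  by_cases hc : ((n.1 : ℝ) + α 0) ^ 2 + ((n.2 : ℝ) + α 1) ^ 2 ≤ k ^ 2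
  · refine ⟨_, Real.sqrt_nonneg _, Or.inl ⟨if_pos hc, ?_⟩⟩
    rw [Real.sq_sqrt (by linarith)]
    ring
  · refine ⟨_, Real.sqrt_nonneg _, Or.inr ⟨if_neg hc, ?_⟩⟩
    rw [Real.sq_sqrt (by linarith)]
    ring

lemma modeFlux_betaN_im_nonpos {k : ℝ} {α : R3} {n : ℤ × ℤ} {a₀ a₁ a₂ : ℂ}
    (hdiv : ((n.1 + α 0 : ℝ) : ℂ) * a₀ + ((n.2 + α 1 : ℝ) : ℂ) * a₁ + betaN k α n * a₂ = 0) :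
    (modeFlux (n.1 + α 0) (n.2 + α 1) (betaN k α n) a₀ a₁ a₂).im ≤ 0 := by
  obtain ⟨σ, hσ, ⟨hβ, -⟩ | ⟨hβ, -⟩⟩ := betaN_cases k α n
  · rw [hβ] at hdiv ⊢
    rw [modeFlux_im_propagating hdiv, neg_mul, neg_nonpos]
    have := Complex.normSq_nonneg
    exact mul_nonneg hσ (add_nonneg (add_nonneg (this _) (this _)) (this _))
  · rw [hβ] at hdiv ⊢
    rw [modeFlux_im_evanescent hdiv]

lemma modeForm_betaN_re_nonneg (h : ℝ) {k : ℝ} {α : R3} {n : ℤ × ℤ} {a₀ a₁ a₂ : ℂ}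
    (hdiv : ((n.1 + α 0 : ℝ) : ℂ) * a₀ + ((n.2 + α 1 : ℝ) : ℂ) * a₁ + betaN k α n * a₂ = 0)
    (hflux : (modeFlux (n.1 + α 0) (n.2 + α 1) (betaN k α n) a₀ a₁ a₂).im = 0) :
    0 ≤ (modeForm h k (n.1 + α 0) (n.2 + α 1) (betaN k α n) a₀ a₁ a₂).re := by
  obtain ⟨σ, hσ, ⟨hβ, hk⟩ | ⟨hβ, hk⟩⟩ := betaN_cases k α n
  · rw [hβ] at hdiv hflux ⊢
    rw [modeForm_re_propagating h hdiv hk, hflux, mul_zero]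
  · rw [hβ] at hdiv ⊢
    rw [modeForm_re_evanescent h hdiv hk]
    have := Complex.normSq_nonneg
    exact mul_nonneg hσ (add_nonneg (add_nonneg (this _) (this _)) (this _))

/-- `f` is integrable on the square and its mean value is the sum of `s`. -/
def ParsevalPair (f : ℝ × ℝ → ℂ) (s : ℤ × ℤ → ℂ) : Prop :=
  IntegrableOn f sq2 ∧ HasSum s ((1 / (4 * (π : ℂ) ^ 2)) * ∫ p in sq2, f p)

namespace ParsevalPair

variable {f g : ℝ × ℝ → ℂ} {s t : ℤ × ℤ → ℂ}

lemma add (hf : ParsevalPair f s) (hg : ParsevalPair g t) :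
    ParsevalPair (fun p => f p + g p) fun n => s n + t n :=
  ⟨hf.1.add hg.1, by rw [integral_add hf.1 hg.1, mul_add]; exact hf.2.add hg.2⟩

lemma sub (hf : ParsevalPair f s) (hg : ParsevalPair g t) :
    ParsevalPair (fun p => f p - g p) fun n => s n - t n :=
  ⟨hf.1.sub hg.1, by rw [integral_sub hf.1 hg.1, mul_sub]; exact hf.2.sub hg.2⟩

lemma const_mul (hf : ParsevalPair f s) (c : ℂ) :
    ParsevalPair (fun p => c * f p) fun n => c * s n :=
  ⟨hf.1.const_mul c, by rw [integral_const_mul, mul_left_comm]; exact hf.2.mul_left c⟩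

lemma mul_conj {u v : R3 → ℂ} (hu : Continuous u) (hv : Continuous v) (t : ℝ) :
    ParsevalPair (fun p => u (bpt p t) * (starRingEnd ℂ) (v (bpt p t)))
      fun n => fourierSq u t n * (starRingEnd ℂ) (fourierSq v t n) :=
  ⟨((hu.comp (continuous_bpt t)).mul
    (Complex.continuous_conj.comp (hv.comp (continuous_bpt t)))).integrableOn_sq2,
    hasSum_fourierSq hu hv t⟩

end ParsevalPair

namespace IsHomSol

variable {h k : ℝ} {α : R3} {εinv : R3 → ℝ} {H : R3 → C3}

lemma contDiff_apply (hH : IsHomSol h k α εinv H) (j : Fin 3) : ContDiff ℝ 2 fun y => H y j :=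
  contDiff_pi.1 hH.smooth j

lemma contDiff_pdA (hH : IsHomSol h k α εinv H) (i j : Fin 3) :
    ContDiff ℝ 1 (pdA α i fun y => H y j) :=
  ContDiff.pdA (by rw [one_add_one_eq_two]; exact hH.contDiff_apply j)

lemma biperiodic_apply (hH : IsHomSol h k α εinv H) (j : Fin 3) : Biperiodic fun y => H y j :=
  hH.periodic.comp fun v => v j

lemma contDiff_curlA (hH : IsHomSol h k α εinv H) (j : Fin 3) :
    ContDiff ℝ 1 fun y => curlA α H y j := by
  fin_cases j
  · simpa only [Fin.zero_eta, curlA_zero] using (hH.contDiff_pdA 1 2).sub (hH.contDiff_pdA 2 1)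
  · simpa only [Fin.mk_one, curlA_one] using (hH.contDiff_pdA 2 0).sub (hH.contDiff_pdA 0 2)
  · simpa only [Fin.reduceFinMk, curlA_two] using (hH.contDiff_pdA 0 1).sub (hH.contDiff_pdA 1 0)

lemma biperiodic_curlA (hH : IsHomSol h k α εinv H) (j : Fin 3) :
    Biperiodic fun y => curlA α H y j := by
  have hp := fun i j => (hH.biperiodic_apply j).pdA (α := α) (i := i)
  fin_cases j
  · simpa only [Fin.zero_eta, curlA_zero] using (hp 1 2).comp₂ (hp 2 1) fun a b => a - b
  · simpa only [Fin.mk_one, curlA_one] using (hp 2 0).comp₂ (hp 0 2) fun a b => a - b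
  · simpa only [Fin.reduceFinMk, curlA_two] using (hp 0 1).comp₂ (hp 1 0) fun a b => a - b

lemma fourierSq_vertical (hα : α 2 = 0) (hH : IsHomSol h k α εinv H) (n : ℤ × ℤ) (j : Fin 3) :
    fourierSq (pdA α 2 fun y => H y j) h n =
      Complex.I * betaN k α n * fourierSq (fun y => H y j) h n := by
  have h1 := hasDerivAt_fourierSq ((hH.contDiff_apply j).of_le one_le_two) h n
  have e : pdA α 2 (fun y => H y j) = pdC 2 fun y => H y j := by
    ext x; simp [pdA, hα]
  rw [e, ← h1.deriv]
  exact hH.radiation n j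

lemma divA_top (hh : 0 < h) (hH : IsHomSol h k α εinv H) {p : ℝ × ℝ} (hp : p ∈ sq2) :
    divA α H (bpt p h) = 0 := by
  have hc : Continuous (divA α H) := by
    simp only [show divA α H = _ from funext (divA_eq α H)]
    exact ((hH.contDiff_pdA 0 0).continuous.add (hH.contDiff_pdA 1 1).continuous).add
      (hH.contDiff_pdA 2 2).continuous
  have hb : Continuous fun t => bpt p t := by
    unfold bpt
    refine continuous_pi fun i => ?_
    fin_cases i <;> simp <;> fun_prop
  have hcl : IsClosed {t | divA α H (bpt p t) = 0} := isClosed_eq (hc.comp hb) continuous_const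
  have hsub : Set.Ioo 0 h ⊆ {t | divA α H (bpt p t) = 0} := fun t ht =>
    hH.divfree _ ⟨hp.1, hp.2, ht⟩
  have := hcl.closure_subset_iff.2 hsub
  rw [closure_Ioo hh.ne] at this
  exact this (Set.right_mem_Icc.2 hh.le)

lemma fourierSq_divfree (hh : 0 < h) (hα : α 2 = 0) (hH : IsHomSol h k α εinv H) (n : ℤ × ℤ) :
    ((n.1 + α 0 : ℝ) : ℂ) * fourierSq (fun y => H y 0) h n +
      ((n.2 + α 1 : ℝ) : ℂ) * fourierSq (fun y => H y 1) h n +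
      betaN k α n * fourierSq (fun y => H y 2) h n = 0 := by
  have hz : fourierSq (divA α H) h n = 0 := by
    rw [fourierSq, setIntegral_congr_fun (g := fun _ => 0) measurableSet_sq2 fun p hp => by
      simp only [hH.divA_top hh hp, zero_mul]]
    simp
  have hc := fun i j => (hH.contDiff_pdA i j).continuous
  have hs := fun j => (hH.contDiff_apply j).of_le one_le_two
  have h01 : Continuous fun y => pdA α 0 (fun y => H y 0) y + pdA α 1 (fun y => H y 1) y :=
    (hc 0 0).add (hc 1 1)
  rw [show divA α H = _ from funext (divA_eq α H),
    fourierSq_add h01 (hc 2 2), fourierSq_add (hc 0 0) (hc 1 1),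
    (fourierSq_pdA_horizontal α (hs 0) (hH.biperiodic_apply 0) h n).1,
    (fourierSq_pdA_horizontal α (hs 1) (hH.biperiodic_apply 1) h n).2,
    hH.fourierSq_vertical hα] at hz
  refine mul_left_cancel₀ Complex.I_ne_zero ?_
  linear_combination hz

lemma fourierSq_curlA (hα : α 2 = 0) (hH : IsHomSol h k α εinv H) (n : ℤ × ℤ) :
    fourierSq (fun y => curlA α H y 0) h n =
      Complex.I * ((n.2 + α 1 : ℝ) : ℂ) * fourierSq (fun y => H y 2) h n -
        Complex.I * betaN k α n * fourierSq (fun y => H y 1) h n ∧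
    fourierSq (fun y => curlA α H y 1) h n =
      Complex.I * betaN k α n * fourierSq (fun y => H y 0) h n -
        Complex.I * ((n.1 + α 0 : ℝ) : ℂ) * fourierSq (fun y => H y 2) h n ∧
    fourierSq (fun y => curlA α H y 2) h n =
      Complex.I * ((n.1 + α 0 : ℝ) : ℂ) * fourierSq (fun y => H y 1) h n -
        Complex.I * ((n.2 + α 1 : ℝ) : ℂ) * fourierSq (fun y => H y 0) h n := by
  have hc := fun i j => (hH.contDiff_pdA i j).continuous
  have hf := fun j => fourierSq_pdA_horizontal α ((hH.contDiff_apply j).of_le one_le_two)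
    (hH.biperiodic_apply j) h n
  simp only [curlA_zero, curlA_one, curlA_two]
  refine ⟨?_, ?_, ?_⟩
  · rw [fourierSq_sub (hc 1 2) (hc 2 1), (hf 2).2, hH.fourierSq_vertical hα]
  · rw [fourierSq_sub (hc 2 0) (hc 0 2), (hf 2).1, hH.fourierSq_vertical hα]
  · rw [fourierSq_sub (hc 0 1) (hc 1 0), (hf 1).1, (hf 0).2]

/-- The Rellich test field `2 x₃ ∂₃H + H`. -/
def multiplier (α : R3) (H : R3 → C3) (x : R3) : C3 :=
  fun j => ((2 * x 2 : ℝ) : ℂ) * pdA α 2 (fun y => H y j) x + H x j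

lemma contDiff_multiplier (hH : IsHomSol h k α εinv H) (j : Fin 3) :
    ContDiff ℝ 1 fun x => multiplier α H x j := by
  refine ContDiff.add (ContDiff.mul (Complex.ofRealCLM.contDiff.comp
    (f := fun x : R3 => 2 * x 2) ?_) (hH.contDiff_pdA 2 j)) ((hH.contDiff_apply j).of_le one_le_two)
  fun_prop

lemma fourierSq_multiplier (hα : α 2 = 0) (hH : IsHomSol h k α εinv H) (n : ℤ × ℤ) (j : Fin 3) :
    fourierSq (fun x => multiplier α H x j) h n =
      2 * h * (Complex.I * betaN k α n * fourierSq (fun y => H y j) h n) +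
        fourierSq (fun y => H y j) h n := by
  have e : fourierSq (fun x => multiplier α H x j) h n =
      fourierSq (fun x => (2 * h : ℂ) * pdA α 2 (fun y => H y j) x + H x j) h n := by
    simp [fourierSq, multiplier, bpt]
  rw [e, fourierSq_add (by have := (hH.contDiff_pdA 2 j).continuous; fun_prop)
    (hH.contDiff_apply j).continuous, fourierSq_const_mul, hH.fourierSq_vertical hα]

/-- `e₃·(curl_α H × H̄)`. -/
def flux (α : R3) (H : R3 → C3) (x : R3) : ℂ :=
  curlA α H x 0 * (starRingEnd ℂ) (H x 1) - curlA α H x 1 * (starRingEnd ℂ) (H x 0)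

/-- The integrand of the boundary term on the top face in the Rellich identity. -/
def boundaryForm (h k : ℝ) (α : R3) (H : R3 → C3) (x : R3) : ℂ :=
  curlA α H x 0 * (starRingEnd ℂ) (multiplier α H x 1) -
    curlA α H x 1 * (starRingEnd ℂ) (multiplier α H x 0) -
    2 * (H x 2 * (starRingEnd ℂ) (pdA α 2 (fun y => H y 2) x)) +
    h * (curlA α H x 0 * (starRingEnd ℂ) (curlA α H x 0) +
      curlA α H x 1 * (starRingEnd ℂ) (curlA α H x 1) +
      curlA α H x 2 * (starRingEnd ℂ) (curlA α H x 2) -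
      k ^ 2 * (H x 0 * (starRingEnd ℂ) (H x 0) + H x 1 * (starRingEnd ℂ) (H x 1) +
        H x 2 * (starRingEnd ℂ) (H x 2)))

lemma hasSum_flux (hα : α 2 = 0) (hH : IsHomSol h k α εinv H) :
    HasSum (fun n : ℤ × ℤ => modeFlux (n.1 + α 0) (n.2 + α 1) (betaN k α n)
      (fourierSq (fun y => H y 0) h n) (fourierSq (fun y => H y 1) h n)
      (fourierSq (fun y => H y 2) h n))
      ((1 / (4 * (π : ℂ) ^ 2)) * ∫ p in sq2, flux α H (bpt p h)) := by
  have hu := fun j => (hH.contDiff_apply j).continuous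
  have hc := fun j => (hH.contDiff_curlA j).continuous
  convert ((ParsevalPair.mul_conj (hc 0) (hu 1) h).sub
    (ParsevalPair.mul_conj (hc 1) (hu 0) h)).2 using 1
  · funext n
    obtain ⟨h0, h1, -⟩ := hH.fourierSq_curlA hα n
    rw [modeFlux, h0, h1]
  · rfl

lemma hasSum_boundaryForm (hα : α 2 = 0) (hH : IsHomSol h k α εinv H) :
    HasSum (fun n : ℤ × ℤ => modeForm h k (n.1 + α 0) (n.2 + α 1) (betaN k α n)
      (fourierSq (fun y => H y 0) h n) (fourierSq (fun y => H y 1) h n)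
      (fourierSq (fun y => H y 2) h n))
      ((1 / (4 * (π : ℂ) ^ 2)) * ∫ p in sq2, boundaryForm h k α H (bpt p h)) := by
  have hu := fun j => (hH.contDiff_apply j).continuous
  have hc := fun j => (hH.contDiff_curlA j).continuous
  have hg := fun j => (hH.contDiff_multiplier j).continuous
  have hd := (hH.contDiff_pdA 2 2).continuous
  have hS := fun {u v : R3 → ℂ} (hu : Continuous u) (hv : Continuous v) =>
    ParsevalPair.mul_conj hu hv h
  convert ((((hS (hc 0) (hg 1)).sub (hS (hc 1) (hg 0))).sub ((hS (hu 2) hd).const_mul 2)).add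
    (((((hS (hc 0) (hc 0)).add (hS (hc 1) (hc 1))).add (hS (hc 2) (hc 2))).sub
      ((((hS (hu 0) (hu 0)).add (hS (hu 1) (hu 1))).add (hS (hu 2) (hu 2))).const_mul
        ((k : ℂ) ^ 2))).const_mul (h : ℂ))).2 using 1
  · funext n
    obtain ⟨h0, h1, h2⟩ := hH.fourierSq_curlA hα n
    rw [modeForm, h0, h1, h2, hH.fourierSq_multiplier hα, hH.fourierSq_multiplier hα,
      hH.fourierSq_vertical hα]
  · rfl

lemma boundaryForm_nonneg (hh : 0 < h) (hα : α 2 = 0) (hH : IsHomSol h k α εinv H)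
    (hflux : (∫ p in sq2, flux α H (bpt p h)).im = 0) :
    0 ≤ (∫ p in sq2, boundaryForm h k α H (bpt p h)).re := by
  have hdiv := hH.fourierSq_divfree hh hα
  have hcast : (1 / (4 * (π : ℂ) ^ 2)) = ((1 / (4 * π ^ 2) : ℝ) : ℂ) := by push_cast; ring
  have h1 := Complex.hasSum_im (hH.hasSum_flux hα)
  have h2 := Complex.hasSum_re (hH.hasSum_boundaryForm hα)
  rw [hcast, Complex.im_ofReal_mul, hflux, mul_zero] at h1
  rw [hcast, Complex.re_ofReal_mul] at h2
  have hzero := (hasSum_zero_iff_of_nonneg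
    (fun n => neg_nonneg.2 (modeFlux_betaN_im_nonpos (hdiv n)))).1 (by simpa using h1.neg)
  have hnn := h2.nonneg fun n =>
    modeForm_betaN_re_nonneg h (hdiv n) (neg_eq_zero.1 (congrFun hzero n))
  have hpos : 0 < 1 / (4 * π ^ 2) := by positivity
  exact nonneg_of_mul_nonneg_right hnn hpos

end IsHomSol

lemma divergence_crossC_conjV {α : R3} {E G : R3 → C3} {x : R3}
    (hE : ∀ j, DifferentiableAt ℝ (fun y => E y j) x)
    (hG : ∀ j, DifferentiableAt ℝ (fun y => G y j) x) :
    ∑ i, pdC i (fun y => crossC (E y) (conjV (G y)) i) x =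
      dotc (curlA α E x) (G x) - dotc (E x) (curlA α G x) := by
  have hm : ∀ i j k : Fin 3, pdC i (fun y => E y j * (starRingEnd ℂ) (G y k) -
      E y k * (starRingEnd ℂ) (G y j)) x =
      pdA α i (fun y => E y j) x * (starRingEnd ℂ) (G x k) +
        E x j * (starRingEnd ℂ) (pdA α i (fun y => G y k) x) -
      (pdA α i (fun y => E y k) x * (starRingEnd ℂ) (G x j) +
        E x k * (starRingEnd ℂ) (pdA α i (fun y => G y j) x)) := by
    intro i j k
    have hp : ∀ j k, DifferentiableAt ℝ (fun y => E y j * (starRingEnd ℂ) (G y k)) x :=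
      fun j k => (hE j).mul (hG k).conj_comp
    rw [pdC_sub (hp j k) (hp k j),
      pdC_mul_conj (hE j) (hG k), pdC_mul_conj (hE k) (hG j)]
  simp only [Fin.sum_univ_three, dotc, curlA_zero, curlA_one, curlA_two, map_sub]
  have e0 := hm 0 1 2
  have e1 := hm 1 2 0
  have e2 := hm 2 0 1
  simp only [crossC, conjV, Matrix.cons_val_zero, Matrix.cons_val_one, Matrix.cons_val]
  rw [e0, e1, e2]
  ring

lemma dotc_self (v : C3) : dotc v v = (nsq v : ℂ) := by
  simp [dotc, nsq, Complex.mul_conj]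

lemma crossC_conjV_contDiff {E G : R3 → C3} (hE : ∀ j, ContDiff ℝ 1 fun y => E y j)
    (hG : ∀ j, ContDiff ℝ 1 fun y => G y j) (i : Fin 3) :
    ContDiff ℝ 1 fun y => crossC (E y) (conjV (G y)) i := by
  have hm : ∀ j k : Fin 3, ContDiff ℝ 1 fun y => E y j * (starRingEnd ℂ) (G y k) :=
    fun j k => (hE j).mul (Complex.conjCLE.contDiff.comp (hG k))
  fin_cases i
  · exact (hm 1 2).sub (hm 2 1)
  · exact (hm 2 0).sub (hm 0 2)
  · exact (hm 0 1).sub (hm 1 0)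

lemma contDiff_dotc_self {E : R3 → C3} (hE : ∀ j, ContDiff ℝ 1 fun y => E y j) :
    ContDiff ℝ 1 fun y => dotc (E y) (E y) :=
  ContDiff.sum fun j _ => (hE j).mul (Complex.conjCLE.contDiff.comp (hE j))

lemma EpsOK.eq_one_top {h : ℝ} {εinv : R3 → ℝ} (hε : EpsOK h εinv) (p : ℝ × ℝ) :
    εinv (bpt p h) = 1 := by
  obtain ⟨η, hη, -, hone⟩ := hε.one_near_top
  exact hone _ (by simpa [bpt] using hη)

lemma EpsOK.one_le {h : ℝ} {εinv : R3 → ℝ} (hε : EpsOK h εinv)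
    (hanti : ∀ x ∈ Omg h, pdR 2 εinv x ≤ 0) {x : R3} (hx : x ∈ Omg h) : 1 ≤ εinv x := by
  have hd : ∀ t, HasDerivAt (fun s => εinv (Function.update x 2 s))
      (pdR 2 εinv (Function.update x 2 t)) t := fun t =>
    ((hε.smooth.differentiable one_ne_zero _).hasFDerivAt.comp_hasDerivAt t
      (hasDerivAt_update x 2 t))
  obtain ⟨hx0, hx1, hx2⟩ := hx
  have hA : AntitoneOn (fun s => εinv (Function.update x 2 s)) (Set.Icc (x 2) h) := by
    refine antitoneOn_of_deriv_nonpos (convex_Icc _ _)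
      (fun t _ => (hd t).continuousAt.continuousWithinAt)
      (fun t _ => (hd t).differentiableAt.differentiableWithinAt) fun t ht => ?_
    rw [interior_Icc] at ht
    rw [(hd t).deriv]
    exact hanti _ ⟨by simpa using hx0, by simpa using hx1, by
      simpa using ⟨hx2.1.trans ht.1, ht.2⟩⟩
  have := hA (Set.left_mem_Icc.2 hx2.2.le) (Set.right_mem_Icc.2 hx2.2.le) hx2.2.le
  obtain ⟨η, hη, -, hone⟩ := hε.one_near_top
  simpa [hone (Function.update x 2 h) (by simpa using hη)] using this

namespace IsHomSol

variable {h k : ℝ} {α : R3} {εinv : R3 → ℝ} {H : R3 → C3}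

lemma contDiff_electric (hε : EpsOK h εinv) (hH : IsHomSol h k α εinv H) (j : Fin 3) :
    ContDiff ℝ 1 fun y => ((εinv y : ℂ) • curlA α H y) j :=
  (Complex.ofRealCLM.contDiff.comp hε.smooth).mul (hH.contDiff_curlA j)

lemma biperiodic_electric (hε : EpsOK h εinv) (hH : IsHomSol h k α εinv H) :
    Biperiodic fun y => (εinv y : ℂ) • curlA α H y := by
  have hc : Biperiodic (curlA α H) := fun x =>
    ⟨funext fun j => (hH.biperiodic_curlA j x).1, funext fun j => (hH.biperiodic_curlA j x).2⟩
  exact hε.periodic.comp₂ hc fun r v => (r : ℂ) • v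

lemma electric_bottom (hH : IsHomSol h k α εinv H) (p : ℝ × ℝ) :
    ((εinv (bpt p 0) : ℂ) • curlA α H (bpt p 0)) 0 = 0 ∧
      ((εinv (bpt p 0) : ℂ) • curlA α H (bpt p 0)) 1 = 0 := by
  have hb := hH.bc_tangential (bpt p 0) (by simp [bpt])
  have h0 := congrFun hb 0
  have h1 := congrFun hb 1
  simp only [crossC, e3, Matrix.cons_val_zero, Matrix.cons_val_one, Matrix.cons_val, zero_mul,
    one_mul, zero_sub, sub_zero, Pi.zero_apply, neg_eq_zero] at h0 h1
  exact ⟨h1, h0⟩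

lemma integral_flux_im (hh : 0 < h) (hε : EpsOK h εinv) (hH : IsHomSol h k α εinv H) :
    (∫ p in sq2, flux α H (bpt p h)).im = 0 := by
  set E : R3 → C3 := fun y => (εinv y : ℂ) • curlA α H y with hE
  have hEd : ∀ j, ContDiff ℝ 1 fun y => E y j := hH.contDiff_electric hε
  have hHd := fun j => (hH.contDiff_apply j).of_le one_le_two
  have key := integral_divergence_Omg hh (fun i y => crossC (E y) (conjV (H y)) i)
    (crossC_conjV_contDiff hEd hHd)
    fun i => (hH.biperiodic_electric hε).comp₂ hH.periodic fun a b => crossC a (conjV b) i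
  have htop : ∀ p, crossC (E (bpt p h)) (conjV (H (bpt p h))) 2 = flux α H (bpt p h) := by
    intro p
    simp [hE, crossC, conjV, flux, hε.eq_one_top p]
  have hbot : ∀ p, crossC (E (bpt p 0)) (conjV (H (bpt p 0))) 2 = 0 := by
    intro p
    obtain ⟨h0, h1⟩ := hH.electric_bottom p
    simp only [crossC, Matrix.cons_val, hE, h0, h1, zero_mul, sub_zero]
  have hdiv : ∀ x ∈ Omg h, ∑ i, pdC i (fun y => crossC (E y) (conjV (H y)) i) x =
      ((k ^ 2 * nsq (H x) - εinv x * nsq (curlA α H x) : ℝ) : ℂ) := by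
    intro x hx
    rw [divergence_crossC_conjV (α := α) (fun j => (hEd j).differentiable one_ne_zero x)
      fun j => (hHd j).differentiable one_ne_zero x, hH.maxwell x hx]
    have e : ∀ (r : ℂ) (a b : C3), dotc (r • a) b = r * dotc a b := by
      intro r a b
      simp [dotc, Finset.mul_sum, mul_assoc]
    rw [e, e, dotc_self, dotc_self]
    push_cast
    rfl
  rw [setIntegral_congr_fun (measurableSet_Omg h) hdiv] at key
  simp only [htop, hbot, integral_zero, sub_zero] at key
  rw [← key, integral_complex_ofReal, Complex.ofReal_im]

end IsHomSol

lemma pdC_dotc_self {α : R3} {i : Fin 3} {E : R3 → C3} {x : R3}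
    (hE : ∀ j, DifferentiableAt ℝ (fun y => E y j) x) :
    pdC i (fun y => dotc (E y) (E y)) x =
      ∑ j, (pdA α i (fun y => E y j) x * (starRingEnd ℂ) (E x j) +
        E x j * (starRingEnd ℂ) (pdA α i (fun y => E y j) x)) := by
  have hd : ∀ j, DifferentiableAt ℝ (fun y => E y j * (starRingEnd ℂ) (E y j)) x :=
    fun j => (hE j).mul (hE j).conj_comp
  simp only [dotc]
  rw [pdC, fderiv_fun_sum fun j _ => hd j, sum_apply]
  exact Finset.sum_congr rfl fun j _ => pdC_mul_conj (hE j) (hE j)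

namespace IsHomSol

variable {h k : ℝ} {α : R3} {εinv : R3 → ℝ} {H : R3 → C3}

/-- The vector field whose divergence gives the Rellich identity. -/
def rellichField (k : ℝ) (α : R3) (εinv : R3 → ℝ) (H : R3 → C3) (i : Fin 3) (x : R3) : ℂ :=
  crossC ((εinv x : ℂ) • curlA α H x) (conjV (multiplier α H x)) i -
    2 * ((εinv x : ℂ) * (H x 2 * (starRingEnd ℂ) (pdA α 2 (fun y => H y i) x))) +
    (if i = 2 then 1 else 0) * ((x 2 : ℝ) *
      ((εinv x : ℂ) * dotc (curlA α H x) (curlA α H x) - k ^ 2 * dotc (H x) (H x)))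

lemma contDiff_rellichField (hε : EpsOK h εinv) (hH : IsHomSol h k α εinv H) (i : Fin 3) :
    ContDiff ℝ 1 (rellichField k α εinv H i) := by
  have hq : ContDiff ℝ 1 fun x => (εinv x : ℂ) := Complex.ofRealCLM.contDiff.comp hε.smooth
  have hx : ContDiff ℝ 1 fun x : R3 => ((x 2 : ℝ) : ℂ) :=
    Complex.ofRealCLM.contDiff.comp (_root_.contDiff_apply ℝ ℝ 2)
  have hs := fun j => (hH.contDiff_apply j).of_le one_le_two
  exact ((crossC_conjV_contDiff (hH.contDiff_electric hε) hH.contDiff_multiplier i).sub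
    (contDiff_const.mul (hq.mul ((hs 2).mul
      (Complex.conjCLE.contDiff.comp (hH.contDiff_pdA 2 i)))))).add
    (contDiff_const.mul (hx.mul ((hq.mul (contDiff_dotc_self hH.contDiff_curlA)).sub
      (contDiff_const.mul (contDiff_dotc_self hs)))))

lemma biperiodic_rellichField (hε : EpsOK h εinv) (hH : IsHomSol h k α εinv H) (i : Fin 3) :
    Biperiodic (rellichField k α εinv H i) := by
  intro x
  have hc := fun j => hH.biperiodic_curlA j x
  have hd := fun j => (hH.biperiodic_apply j).pdA (α := α) (i := 2) x
  have hu := fun j => hH.biperiodic_apply j x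
  simp only at hc hu
  constructor
  · simp [rellichField, multiplier, crossC, conjV, dotc, (hε.periodic x).1, (hc _).1, (hd _).1,
      (hu _).1]
  · simp [rellichField, multiplier, crossC, conjV, dotc, (hε.periodic x).2, (hc _).2, (hd _).2,
      (hu _).2]

lemma sum_pdA_vertical (hH : IsHomSol h k α εinv H) {x : R3} (hx : x ∈ Omg h) :
    ∑ i, pdA α i (pdA α 2 fun y => H y i) x = 0 := by
  have hopen : IsOpen (Omg h) := by
    rw [Omg_eq]
    exact isOpen_set_pi Set.finite_univ fun _ _ => isOpen_Ioo
  have he : divA α H =ᶠ[nhds x] fun _ => 0 :=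
    Filter.eventuallyEq_of_mem (hopen.mem_nhds hx) hH.divfree
  have hz : pdA α 2 (divA α H) x = 0 := by
    rw [pdA, pdC, he.fderiv_eq, he.eq_of_nhds]
    simp
  have hd := fun i j => (hH.contDiff_pdA i j).differentiable one_ne_zero x
  have h01 : DifferentiableAt ℝ
      (fun y => pdA α 0 (fun y => H y 0) y + pdA α 1 (fun y => H y 1) y) x :=
    (hd 0 0).add (hd 1 1)
  rw [show divA α H = _ from funext (divA_eq α H), pdA_add h01 (hd 2 2),
    pdA_add (hd 0 0) (hd 1 1)] at hz
  rw [Fin.sum_univ_three, pdA_comm (hH.contDiff_apply 0), pdA_comm (hH.contDiff_apply 1)]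
  exact hz

lemma pdA_multiplier (hH : IsHomSol h k α εinv H) (i j : Fin 3) (x : R3) :
    pdA α i (fun y => multiplier α H y j) x =
      (2 * x 2 : ℝ) * pdA α 2 (pdA α i fun y => H y j) x +
        (if i = 2 then 2 else 0) * pdA α 2 (fun y => H y j) x + pdA α i (fun y => H y j) x := by
  have hr : DifferentiableAt ℝ (fun y : R3 => 2 * y 2) x := by fun_prop
  have hd := (hH.contDiff_pdA 2 j).differentiable one_ne_zero x
  have hu := (hH.contDiff_apply j).differentiable two_ne_zero x
  have hrd : DifferentiableAt ℝ
      (fun y => ((2 * y 2 : ℝ) : ℂ) * pdA α 2 (fun y => H y j) y) x :=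
    DifferentiableAt.mul (Complex.ofRealCLM.differentiableAt.comp x hr) hd
  have e : pdR i (fun y => 2 * y 2) x = if i = 2 then 2 else 0 := by
    have := pdR_coord (i := i) (x := x) 2
    rw [pdR] at this ⊢
    rw [fderiv_const_mul (by fun_prop)]
    simp [this]
  unfold multiplier
  rw [pdA_add hrd hu, pdA_ofReal_mul hr hd, pdA_comm (hH.contDiff_apply j), e]
  split_ifs <;> simp

lemma curlA_multiplier (hH : IsHomSol h k α εinv H) (x : R3) :
    curlA α (multiplier α H) x =
      ![(2 * x 2 : ℝ) * pdA α 2 (fun y => curlA α H y 0) x -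
          2 * pdA α 2 (fun y => H y 1) x + curlA α H x 0,
        (2 * x 2 : ℝ) * pdA α 2 (fun y => curlA α H y 1) x +
          2 * pdA α 2 (fun y => H y 0) x + curlA α H x 1,
        (2 * x 2 : ℝ) * pdA α 2 (fun y => curlA α H y 2) x + curlA α H x 2] := by
  have hd := fun i j => (hH.contDiff_pdA i j).differentiable one_ne_zero x
  have hs : ∀ i j a b : Fin 3,
      pdA α 2 (fun y => pdA α i (fun y => H y a) y - pdA α j (fun y => H y b) y) x =
      pdA α 2 (pdA α i fun y => H y a) x - pdA α 2 (pdA α j fun y => H y b) x :=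
    fun i j a b => pdA_sub (hd i a) (hd j b)
  ext j
  fin_cases j <;>
    simp [curlA_zero, curlA_one, curlA_two, hs, hH.pdA_multiplier] <;> ring

lemma divergence_rellichField (hε : EpsOK h εinv) (hH : IsHomSol h k α εinv H) {x : R3}
    (hx : x ∈ Omg h) :
    (∑ i, pdC i (rellichField k α εinv H i) x).re =
      x 2 * pdR 2 εinv x * nsq (curlA α H x) -
        2 * εinv x * nsq (fun j => pdA α 2 (fun y => H y j) x) -
        2 * (H x 2 * ∑ i, (pdR i εinv x : ℂ) *
          (starRingEnd ℂ) (pdA α 2 (fun y => H y i) x)).re := by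
  have hq : DifferentiableAt ℝ εinv x := hε.smooth.differentiable one_ne_zero x
  have hqC : DifferentiableAt ℝ (fun y => (εinv y : ℂ)) x :=
    Complex.ofRealCLM.differentiableAt.comp x hq
  have hx2 : DifferentiableAt ℝ (fun y : R3 => y 2) x := by fun_prop
  have hu := fun j => (hH.contDiff_apply j).differentiable two_ne_zero x
  have hd := fun i j => (hH.contDiff_pdA i j).differentiable one_ne_zero x
  have hcd := fun j => (hH.contDiff_curlA j).differentiable one_ne_zero x
  have hE := fun j => (hH.contDiff_electric hε j).differentiable one_ne_zero x
  have hG := fun j => (hH.contDiff_multiplier j).differentiable one_ne_zero x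
  have hX := fun i => (crossC_conjV_contDiff (hH.contDiff_electric hε)
    hH.contDiff_multiplier i).differentiable one_ne_zero x
  have hcc := (contDiff_dotc_self hH.contDiff_curlA).differentiable one_ne_zero x
  have hHH := (contDiff_dotc_self fun j =>
    (hH.contDiff_apply j).of_le one_le_two).differentiable one_ne_zero x
  have hHd : ∀ i, DifferentiableAt ℝ
      (fun y => H y 2 * (starRingEnd ℂ) (pdA α 2 (fun y => H y i) y)) x :=
    fun i => (hu 2).mul (hd 2 i).conj_comp
  have hqHd : ∀ i, DifferentiableAt ℝ
      (fun y => (εinv y : ℂ) * (H y 2 * (starRingEnd ℂ) (pdA α 2 (fun y => H y i) y))) x :=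
    fun i => hqC.mul (hHd i)
  have hqcc : DifferentiableAt ℝ (fun y => (εinv y : ℂ) * dotc (curlA α H y) (curlA α H y)) x :=
    hqC.mul hcc
  have hkHH : DifferentiableAt ℝ (fun y => (k : ℂ) ^ 2 * dotc (H y) (H y)) x := hHH.const_mul _
  have hL : DifferentiableAt ℝ (fun y => (εinv y : ℂ) * dotc (curlA α H y) (curlA α H y) -
      (k : ℂ) ^ 2 * dotc (H y) (H y)) x := hqcc.sub hkHH
  have hxL : DifferentiableAt ℝ (fun y => ((y 2 : ℝ) : ℂ) * ((εinv y : ℂ) *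
      dotc (curlA α H y) (curlA α H y) - (k : ℂ) ^ 2 * dotc (H y) (H y))) x :=
    (Complex.ofRealCLM.differentiableAt.comp x hx2).mul hL
  have hF : ∀ i, pdC i (rellichField k α εinv H i) x =
      pdC i (fun y => crossC ((εinv y : ℂ) • curlA α H y) (conjV (multiplier α H y)) i) x -
      2 * (εinv x * (pdA α i (fun y => H y 2) x * (starRingEnd ℂ) (pdA α 2 (fun y => H y i) x) +
        H x 2 * (starRingEnd ℂ) (pdA α i (pdA α 2 fun y => H y i) x)) +
        pdR i εinv x * (H x 2 * (starRingEnd ℂ) (pdA α 2 (fun y => H y i) x))) +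
      (if i = 2 then 1 else 0) * pdC i (fun y => ((y 2 : ℝ) : ℂ) * ((εinv y : ℂ) *
        dotc (curlA α H y) (curlA α H y) - (k : ℂ) ^ 2 * dotc (H y) (H y))) x := by
    intro i
    have h1 : DifferentiableAt ℝ (fun y =>
        crossC ((εinv y : ℂ) • curlA α H y) (conjV (multiplier α H y)) i -
        2 * ((εinv y : ℂ) * (H y 2 * (starRingEnd ℂ) (pdA α 2 (fun y => H y i) y)))) x :=
      (hX i).sub ((hqHd i).const_mul 2)
    unfold rellichField
    rw [pdC_add h1 (hxL.const_mul _), pdC_sub (hX i) ((hqHd i).const_mul 2),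
      pdC_const_mul _ (hqHd i), pdC_const_mul _ hxL, pdC_ofReal_mul hq (hHd i),
      pdC_mul_conj (hu 2) (hd 2 i)]
  have hL2 : pdC 2 (fun y => ((y 2 : ℝ) : ℂ) * ((εinv y : ℂ) *
        dotc (curlA α H y) (curlA α H y) - (k : ℂ) ^ 2 * dotc (H y) (H y))) x =
      x 2 * (εinv x * pdC 2 (fun y => dotc (curlA α H y) (curlA α H y)) x +
        pdR 2 εinv x * dotc (curlA α H x) (curlA α H x) -
        k ^ 2 * pdC 2 (fun y => dotc (H y) (H y)) x) +
      (εinv x * dotc (curlA α H x) (curlA α H x) - k ^ 2 * dotc (H x) (H x)) := by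
    rw [pdC_ofReal_mul hx2 hL, pdC_sub hqcc hkHH, pdC_const_mul _ hHH, pdC_ofReal_mul hq hcc,
      pdR_coord]
    simp
  have hdf := hH.sum_pdA_vertical hx
  have hm := hH.maxwell x hx
  have hc0 := curlA_zero α H x
  have hc1 := curlA_one α H x
  simp only [hF, Finset.sum_add_distrib, Finset.sum_sub_distrib]
  rw [divergence_crossC_conjV (α := α) hE hG, hm, hH.curlA_multiplier]
  simp only [Fin.sum_univ_three, hL2, pdC_dotc_self (α := α) hcd,
    pdC_dotc_self (α := α) hu, Fin.reduceEq, if_false, if_true, one_mul, zero_mul,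
    zero_add] at hdf ⊢
  simp only [Fin.sum_univ_three, dotc, nsq, multiplier, Pi.smul_apply, smul_eq_mul,
    Matrix.cons_val_zero, Matrix.cons_val_one, Matrix.cons_val]
  have ha1 : pdA α 1 (fun y => H y 2) x = curlA α H x 0 + pdA α 2 (fun y => H y 1) x := by
    linear_combination -hc0
  have ha0 : pdA α 0 (fun y => H y 2) x = pdA α 2 (fun y => H y 0) x - curlA α H x 1 := by
    linear_combination hc1
  rw [ha0, ha1, eq_neg_of_add_eq_zero_right hdf, ← Complex.ofReal_pow]
  generalize pdA α 0 (pdA α 2 fun y => H y 0) x = p0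
  generalize pdA α 1 (pdA α 2 fun y => H y 1) x = p1
  generalize pdA α 2 (fun y => curlA α H y 0) x = e0
  generalize pdA α 2 (fun y => curlA α H y 1) x = e1
  generalize pdA α 2 (fun y => curlA α H y 2) x = e2
  generalize pdA α 2 (fun y => H y 0) x = d0
  generalize pdA α 2 (fun y => H y 1) x = d1
  generalize pdA α 2 (fun y => H y 2) x = d2
  generalize curlA α H x 0 = c0
  generalize curlA α H x 1 = c1
  generalize curlA α H x 2 = c2
  generalize H x 0 = u0
  generalize H x 1 = u1
  generalize H x 2 = u2
  generalize pdR 0 εinv x = q0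
  generalize pdR 1 εinv x = q1
  generalize pdR 2 εinv x = q2
  generalize εinv x = q
  generalize x 2 = t
  simp only [map_add, map_sub, map_mul, map_neg, map_ofNat, Complex.conj_ofReal, Complex.add_re,
    Complex.add_im, Complex.sub_re, Complex.sub_im, Complex.mul_re, Complex.mul_im, Complex.neg_re,
    Complex.neg_im, Complex.conj_re, Complex.conj_im, Complex.ofReal_re, Complex.ofReal_im,
    Complex.re_ofNat, Complex.im_ofNat, Complex.normSq_apply]
  ring

end IsHomSol

lemma hasDerivAt_mul_tan {l s : ℝ} (hs : cos s ≠ 0) (h : ℝ) {t : ℝ} (ht : l * (t - h) = s) :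
    HasDerivAt (fun t => l * tan (l * (t - h))) (l ^ 2 + (l * tan s) ^ 2) t := by
  have h1 : HasDerivAt (fun t => l * (t - h)) l t := by
    simpa using ((hasDerivAt_id t).sub_const h).const_mul l
  subst ht
  refine (((hasDerivAt_tan hs).comp t h1).const_mul l).congr_deriv ?_
  rw [tan_eq_sin_div_cos]
  field_simp
  rw [cos_sq_add_sin_sq, mul_one]

/-- Poincaré inequality in the vertical direction, for functions vanishing on the bottom face. -/
lemma integral_normSq_le {h : ℝ} (hh : 0 < h) {u : R3 → ℂ} (hu : ContDiff ℝ 1 u)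
    (hbot : ∀ p, u (bpt p 0) = 0) :
    ∫ x in Omg h, Complex.normSq (u x) ≤
      h ^ 2 / 2 * ∫ x in Omg h, Complex.normSq (pdC 2 u x) := by
  set l := √2 / h with hl
  have hlh : l * h = √2 := div_mul_cancel₀ _ hh.ne'
  have hl2 : l ^ 2 = 2 / h ^ 2 := by rw [hl, div_pow, sq_sqrt zero_le_two]
  set P : ℝ → ℝ := fun t => l * tan (l * (t - h)) with hP
  have hcos : ∀ t ∈ Set.Icc 0 h, 0 < cos (l * (t - h)) := by
    intro t ht
    have hlpos : 0 < l := by positivity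
    have hs : √2 < 3 / 2 := by
      rw [sqrt_lt' (by norm_num)]; norm_num
    have h1 : -√2 ≤ l * (t - h) := by nlinarith [ht.1]
    have h2 : l * (t - h) ≤ 0 := mul_nonpos_of_nonneg_of_nonpos hlpos.le (by linarith [ht.2])
    exact cos_pos_of_mem_Ioo ⟨by linarith [pi_gt_three], by linarith [pi_pos]⟩
  have hcell : ∀ x ∈ cell h, x 2 ∈ Set.Icc 0 h := fun x hx => ⟨hx.1 2, hx.2 2⟩
  set V : R3 → ℝ := fun x => P (x 2) * Complex.normSq (u x) with hVdef
  have hns : ContDiff ℝ 1 fun x => Complex.normSq (u x) := by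
    simp only [Complex.normSq_apply]
    have h1 := Complex.reCLM.contDiff.comp hu
    have h2 := Complex.imCLM.contDiff.comp hu
    exact (h1.mul h1).add (h2.mul h2)
  have hV : ∀ x ∈ cell h, ContDiffAt ℝ 1 V x := by
    intro x hx
    refine ContDiffAt.mul (contDiffAt_const.mul ?_) hns.contDiffAt
    exact (contDiffAt_tan.2 (hcos _ (hcell x hx)).ne').comp x
      (f := fun y : R3 => l * (y 2 - h)) (by fun_prop)
  have hderiv : ∀ x ∈ cell h, l ^ 2 * Complex.normSq (u x) ≤
      fderiv ℝ V x (Pi.single 2 1) + Complex.normSq (pdC 2 u x) := by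
    intro x hx
    have hPd : HasDerivAt P _ (x 2) := hasDerivAt_mul_tan (hcos _ (hcell x hx)).ne' h rfl
    have h1 : HasFDerivAt (fun y : R3 => P (y 2)) _ x :=
      hPd.comp_hasFDerivAt (f := fun y : R3 => y 2) x (hasFDerivAt_apply (𝕜 := ℝ) 2 x)
    have hux := (hu.differentiable one_ne_zero x).hasFDerivAt
    have hre : HasFDerivAt (fun y => (u y).re) _ x := Complex.reCLM.hasFDerivAt.comp x hux
    have him : HasFDerivAt (fun y => (u y).im) _ x := Complex.imCLM.hasFDerivAt.comp x hux
    have hw : HasFDerivAt (fun y => (u y).re * (u y).re + (u y).im * (u y).im) _ x :=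
      (hre.mul hre).add (him.mul him)
    have e : V = (fun y => P (y 2)) * fun y => (u y).re * (u y).re + (u y).im * (u y).im :=
      funext fun y => congrArg (P (y 2) * ·) (Complex.normSq_apply (u y))
    rw [e, (h1.mul hw).fderiv]
    simp only [pdC, Complex.normSq_apply, add_apply, smul_apply,
      ContinuousLinearMap.comp_apply, Complex.reCLM_apply, Complex.imCLM_apply, smul_eq_mul,
      ContinuousLinearMap.proj_apply, Pi.single_eq_same]
    generalize fderiv ℝ u x (Pi.single 2 1) = d
    have e1 := sq_nonneg (d.re + P (x 2) * (u x).re)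
    have e2 := sq_nonneg (d.im + P (x 2) * (u x).im)
    simp only [hP] at e1 e2 ⊢
    nlinarith
  have hcont : ContinuousOn (fun x => fderiv ℝ V x (Pi.single 2 1)) (cell h) := fun x hx =>
    (((hV x hx).fderiv_right (m := 0) (by simp)).continuousAt.clm_apply
      continuousAt_const).continuousWithinAt
  have hd : Continuous fun x => Complex.normSq (pdC 2 u x) := Complex.continuous_normSq.comp
    (ContDiff.pdC (n := 0) (by simpa using hu)).continuous
  have hmono := setIntegral_mono_on ((hns.continuous.integrableOn_Omg h).const_mul (l ^ 2))
    (hcont.integrableOn_Omg.add (hd.integrableOn_Omg h)) (measurableSet_Omg h)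
    fun x hx => hderiv x (Omg_subset_cell h hx)
  have hz : ∫ x in Omg h, fderiv ℝ V x (Pi.single 2 1) = 0 := by
    have h1 : ∀ p, V (bpt p h) = 0 := fun p => by simp [hVdef, hP, bpt]
    have h0 : ∀ p, V (bpt p 0) = 0 := fun p => by simp [hVdef, hbot p]
    rw [integral_fderiv_vertical hh V hV]
    simp [h1, h0]
  simp only [Pi.add_apply] at hmono
  rw [integral_const_mul, integral_add hcont.integrableOn_Omg (hd.integrableOn_Omg h), hz, zero_add,
    hl2] at hmono
  have := mul_le_mul_of_nonneg_left hmono (by positivity : 0 ≤ h ^ 2 / 2)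
  rwa [← mul_assoc, div_mul_div_cancel₀ (by positivity), div_self (by positivity), one_mul] at this

lemma neg_le_two_mul_re_mul_conj {μ : ℝ} (hμ : 0 < μ) (q : ℝ) (a b : ℂ) :
    -(μ * q ^ 2 * Complex.normSq a + 1 / μ * Complex.normSq b) ≤
      2 * (a * (q * (starRingEnd ℂ) b)).re := by
  have e1 := mul_nonneg (one_div_pos.2 hμ).le (add_nonneg (sq_nonneg (μ * q * a.re + b.re))
    (sq_nonneg (μ * q * a.im + b.im)))
  have e2 : 1 / μ * ((μ * q * a.re + b.re) ^ 2 + (μ * q * a.im + b.im) ^ 2) =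
      μ * q ^ 2 * Complex.normSq a + 1 / μ * Complex.normSq b +
        2 * (a * (q * (starRingEnd ℂ) b)).re := by
    simp only [Complex.normSq_apply, Complex.mul_re, Complex.mul_im, Complex.conj_re,
      Complex.conj_im, Complex.ofReal_re, Complex.ofReal_im]
    field_simp
    ring
  linarith

lemma neg_le_two_mul_re_mul_conj_of_abs_le {μ M q : ℝ} (hμ : 0 < μ) (hq : |q| ≤ M) (a b : ℂ) :
    -(M * (μ * Complex.normSq a + 1 / μ * Complex.normSq b)) ≤
      2 * (a * (q * (starRingEnd ℂ) b)).re := by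
  have hnn : 0 ≤ μ * Complex.normSq a + 1 / μ * Complex.normSq b := by
    have := Complex.normSq_nonneg a
    have := Complex.normSq_nonneg b
    positivity
  refine le_trans (neg_le_neg (mul_le_mul_of_nonneg_right hq hnn)) ?_
  obtain ⟨s, hs, hqs⟩ : ∃ s : ℝ, s ^ 2 = 1 ∧ q = |q| * s := by
    rcases le_total 0 q with h | h
    · exact ⟨1, by norm_num, by rw [abs_of_nonneg h, mul_one]⟩
    · exact ⟨-1, by norm_num, by rw [abs_of_nonpos h]; ring⟩
  have h1 := neg_le_two_mul_re_mul_conj hμ s a b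
  rw [hs, mul_one] at h1
  have e : a * (q * (starRingEnd ℂ) b) = (|q| : ℝ) * (a * (s * (starRingEnd ℂ) b)) := by
    have e' : (q : ℂ) = (|q| : ℝ) * (s : ℂ) := by rw [← Complex.ofReal_mul, ← hqs]
    rw [e']
    ring
  rw [e, Complex.re_ofReal_mul]
  linarith [mul_le_mul_of_nonneg_left h1 (abs_nonneg q)]

namespace IsHomSol

variable {h k : ℝ} {α : R3} {εinv : R3 → ℝ} {H : R3 → C3}

lemma continuous_nsq_pdA (hH : IsHomSol h k α εinv H) :
    Continuous fun x => nsq fun j => pdA α 2 (fun y => H y j) x :=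
  continuous_finsetSum _ fun j _ =>
    Complex.continuous_normSq.comp (hH.contDiff_pdA 2 j).continuous

lemma continuous_coupling (hε : EpsOK h εinv) (hH : IsHomSol h k α εinv H) :
    Continuous fun x => (H x 2 * ∑ i, (pdR i εinv x : ℂ) *
      (starRingEnd ℂ) (pdA α 2 (fun y => H y i) x)).re :=
  Complex.continuous_re.comp ((hH.contDiff_apply 2).continuous.mul
    (continuous_finsetSum _ fun i _ =>
      (Complex.continuous_ofReal.comp
        (ContDiff.pdR (n := 0) (by simpa using hε.smooth)).continuous).mul
        (Complex.continuous_conj.comp (hH.contDiff_pdA 2 i).continuous)))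

lemma continuous_vertical (hε : EpsOK h εinv) (hH : IsHomSol h k α εinv H) :
    Continuous fun x => 2 * εinv x * nsq (fun j => pdA α 2 (fun y => H y j) x) +
      2 * (H x 2 * ∑ i, (pdR i εinv x : ℂ) *
        (starRingEnd ℂ) (pdA α 2 (fun y => H y i) x)).re :=
  ((hε.smooth.continuous.const_mul 2).mul hH.continuous_nsq_pdA).add
    ((hH.continuous_coupling hε).const_mul 2)

lemma integral_rellich (hh : 0 < h) (hε : EpsOK h εinv) (hH : IsHomSol h k α εinv H) :
    ∫ x in Omg h, x 2 * pdR 2 εinv x * nsq (curlA α H x) =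
      (∫ x in Omg h, (2 * εinv x * nsq (fun j => pdA α 2 (fun y => H y j) x) +
        2 * (H x 2 * ∑ i, (pdR i εinv x : ℂ) *
          (starRingEnd ℂ) (pdA α 2 (fun y => H y i) x)).re)) +
      (∫ p in sq2, boundaryForm h k α H (bpt p h)).re := by
  have key := integral_divergence_Omg hh (rellichField k α εinv H) (hH.contDiff_rellichField hε)
    (hH.biperiodic_rellichField hε)
  have htop : ∀ p, rellichField k α εinv H 2 (bpt p h) = boundaryForm h k α H (bpt p h) := by
    intro p
    simp [rellichField, boundaryForm, hε.eq_one_top p, crossC, conjV, dotc, Fin.sum_univ_three,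
      show bpt p h 2 = h from rfl]
  have hbot : ∀ p, rellichField k α εinv H 2 (bpt p 0) = 0 := by
    intro p
    obtain ⟨h0, h1⟩ := hH.electric_bottom p
    simp [rellichField, crossC, h0, h1, hH.bc_normal (bpt p 0) rfl, show bpt p 0 2 = 0 from rfl]
  have hint : IntegrableOn (fun x => ∑ i, pdC i (rellichField k α εinv H i) x) (Omg h) :=
    (continuous_finsetSum _ fun i _ => (ContDiff.pdC (n := 0)
      (by simpa using hH.contDiff_rellichField hε i)).continuous).integrableOn_Omg h
  have hre := congrArg Complex.re key
  simp only [htop, hbot, integral_zero, sub_zero] at hre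
  have hI : (∫ x in Omg h, ∑ i, pdC i (rellichField k α εinv H i) x).re =
      ∫ x in Omg h, (∑ i, pdC i (rellichField k α εinv H i) x).re := (integral_re hint).symm
  have hint' : IntegrableOn (fun x => (∑ i, pdC i (rellichField k α εinv H i) x).re) (Omg h) :=
    hint.re
  rw [← hre, hI, ← integral_add ((hH.continuous_vertical hε).integrableOn_Omg h) hint']
  refine setIntegral_congr_fun (measurableSet_Omg h) fun x hx => ?_
  simp only [hH.divergence_rellichField hε hx]
  ring

end IsHomSol

/-- Under the non-trapping assumptions (a), (b), (c) there is a constant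
`C > 0`, independent of the wave number `k`, such that every homogeneous radiating
solution `H` satisfies `C ∫_Ω |∂H/∂x₃|² dx ≤ ∫_Ω x₃ (∂ε_r⁻¹/∂x₃) |curl_α H|² dx`. -/
theorem solution_estimate
    (h : ℝ) (hh : 0 < h) (α : R3) (hα : α 2 = 0)
    (εinv : R3 → ℝ) (hε : EpsOK h εinv) (hnt : NonTrapping h εinv) :
    ∃ C : ℝ, 0 < C ∧ ∀ k : ℝ, 0 < k → ∀ H : R3 → C3, IsHomSol h k α εinv H →
      C * (∫ x in Omg h, nsq (pdV 2 H x))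
        ≤ ∫ x in Omg h, x 2 * pdR 2 εinv x * nsq (curlA α H x) := by
  obtain ⟨hanti, -, δ, hδ, Mt, Mz, hMt, hMz, hsmall⟩ := hnt
  have hδ0 : 0 < δ := by linarith
  have hμ : 0 < √2 / h := by positivity
  set a := 2 - 1 / δ with ha
  set m := δ * Mt ^ 2 + √2 / h * Mz with hm
  set b := 2 - Mz * (1 / (√2 / h)) - m * (h ^ 2 / 2) with hb
  have ha0 : 0 < a := by
    rw [ha, sub_pos, div_lt_iff₀ hδ0]
    linarith
  have hb0 : 0 < b := by
    have e : b = h ^ 2 * (2 / h ^ 2 - (δ / 2 * Mt ^ 2 + √2 / h * Mz)) := by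
      have h2 : √2 ^ 2 = 2 := sq_sqrt zero_le_two
      have h3 : 1 / (√2 / h) = h * √2 / 2 := by
        field_simp
        exact h2.symm
      rw [hb, hm, h3]
      field_simp
      ring
    rw [e]
    exact mul_pos (by positivity) (sub_pos.2 hsmall)
  refine ⟨min a b, lt_min ha0 hb0, fun k _ H hH => ?_⟩
  have hD : ∀ x, nsq (pdV 2 H x) = nsq fun j => pdA α 2 (fun y => H y j) x := by
    intro x
    exact congrArg nsq (funext fun j => by simp [pdV, pdA, hα])
  set D : Fin 3 → R3 → ℝ := fun j x => Complex.normSq (pdA α 2 (fun y => H y j) x) with hDdef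
  have hDc : ∀ j, Continuous (D j) := fun j =>
    Complex.continuous_normSq.comp (hH.contDiff_pdA 2 j).continuous
  have hNc : Continuous fun x => Complex.normSq (H x 2) :=
    Complex.continuous_normSq.comp (hH.contDiff_apply 2).continuous
  have hpoinc : ∫ x in Omg h, Complex.normSq (H x 2) ≤ h ^ 2 / 2 * ∫ x in Omg h, D 2 x := by
    have e : D 2 = fun x => Complex.normSq (pdC 2 (fun y => H y 2) x) := by
      ext x
      simp [hDdef, pdA, hα]
    rw [e]
    exact integral_normSq_le hh ((hH.contDiff_apply 2).of_le one_le_two) fun p =>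
      hH.bc_normal _ rfl
  have hpt : ∀ x ∈ Omg h, a * (D 0 x + D 1 x) + (b + m * (h ^ 2 / 2)) * D 2 x -
      m * Complex.normSq (H x 2) ≤
      2 * εinv x * nsq (fun j => pdA α 2 (fun y => H y j) x) +
        2 * (H x 2 * ∑ i, (pdR i εinv x : ℂ) *
          (starRingEnd ℂ) (pdA α 2 (fun y => H y i) x)).re := by
    intro x hx
    have y0 := neg_le_two_mul_re_mul_conj hδ0 (pdR 0 εinv x) (H x 2) (pdA α 2 (fun y => H y 0) x)
    have y1 := neg_le_two_mul_re_mul_conj hδ0 (pdR 1 εinv x) (H x 2) (pdA α 2 (fun y => H y 1) x)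
    have y2 := neg_le_two_mul_re_mul_conj_of_abs_le hμ (hMz x hx) (H x 2)
      (pdA α 2 (fun y => H y 2) x)
    have hN := Complex.normSq_nonneg (H x 2)
    have t := mul_le_mul_of_nonneg_left (hMt x hx) (mul_nonneg hδ0.le hN)
    have hq : nsq (fun j => pdA α 2 (fun y => H y j) x) ≤
        εinv x * nsq (fun j => pdA α 2 (fun y => H y j) x) :=
      le_mul_of_one_le_left (Finset.sum_nonneg fun j _ => Complex.normSq_nonneg _)
        (hε.one_le hanti hx)
    have hsum : nsq (fun j => pdA α 2 (fun y => H y j) x) = D 0 x + D 1 x + D 2 x := by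
      simp [nsq, Fin.sum_univ_three, hDdef]
    rw [hsum] at hq
    rw [Fin.sum_univ_three, mul_add (H x 2), mul_add (H x 2), Complex.add_re, Complex.add_re,
      mul_assoc 2, hsum, ha, hb, hm]
    simp only [hDdef] at hq ⊢
    linarith
  have hDi : ∀ j, IntegrableOn (D j) (Omg h) := fun j => (hDc j).integrableOn_Omg h
  have hNi := hNc.integrableOn_Omg h
  have hI : ∀ j, 0 ≤ ∫ x in Omg h, D j x := fun j =>
    integral_nonneg fun x => Complex.normSq_nonneg _
  have hm0 : 0 ≤ m := by
    have hMz0 : 0 ≤ Mz := by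
      have hx : (![π, π, h / 2] : R3) ∈ Omg h := by
        simp [Omg, pi_pos, hh]
      exact (abs_nonneg _).trans (hMz _ hx)
    positivity
  have h01 : IntegrableOn (fun x => a * (D 0 x + D 1 x)) (Omg h) :=
    ((hDi 0).add (hDi 1)).const_mul a
  have h2 : IntegrableOn (fun x => (b + m * (h ^ 2 / 2)) * D 2 x) (Omg h) := (hDi 2).const_mul _
  have h012 : IntegrableOn (fun x => a * (D 0 x + D 1 x) + (b + m * (h ^ 2 / 2)) * D 2 x)
    (Omg h) := h01.add h2
  have hmono := setIntegral_mono_on (h012.sub (hNi.const_mul m))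
    (hH.continuous_vertical hε |>.integrableOn_Omg h) (measurableSet_Omg h) hpt
  simp only [Pi.sub_apply] at hmono
  rw [integral_sub h012 (hNi.const_mul m), integral_add h01 h2, integral_const_mul,
    integral_const_mul, integral_const_mul, integral_add (hDi 0) (hDi 1)] at hmono
  have hsplit : ∫ x in Omg h, nsq (pdV 2 H x) =
      (∫ x in Omg h, D 0 x) + (∫ x in Omg h, D 1 x) + ∫ x in Omg h, D 2 x := by
    have hadd : IntegrableOn (fun x => D 0 x + D 1 x) (Omg h) := (hDi 0).add (hDi 1)
    rw [← integral_add (hDi 0) (hDi 1), ← integral_add hadd (hDi 2)]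
    refine integral_congr_ae (.of_forall fun x => ?_)
    simp only [hD]
    simp [nsq, Fin.sum_univ_three, hDdef]
  have hflux := hH.boundaryForm_nonneg hh hα (hH.integral_flux_im hh hε)
  rw [hH.integral_rellich hh hε, hsplit]
  have l0 := mul_le_mul_of_nonneg_right (min_le_left a b) (hI 0)
  have l1 := mul_le_mul_of_nonneg_right (min_le_left a b) (hI 1)
  have l2 := mul_le_mul_of_nonneg_right (min_le_right a b) (hI 2)
  have l3 := mul_le_mul_of_nonneg_left hpoinc hm0
  linarith
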